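/- arXiv:1806.11087 — 6 statements merged into one kernel-verified Lean document; each statement's English description precedes it below -/
import Mathlib

section
/- Let X₁ and X₂ be Boolean spaces, and for i = 1,2 let Γᵢ be a subgroup of the group of homeomorphisms of Xᵢ such that every element of Γᵢ has compact open support, and suppose each pair (Γᵢ, Xᵢ) satisfies conditions (F1), (F2) and (F3). Then every abstract group isomorphism Φ : Γ₁ → Γ₂ is spatially implemented: there exists a homeomorphism φ : X₁ → X₂ such that Φ(γ) = φ ∘ γ ∘ φ⁻¹ for every γ ∈ Γ₁. -/
/-! ## Basic setup: the group of self-homeomorphisms of a space -/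

instance homeoGroup (X : Type*) [TopologicalSpace X] : Group (X ≃ₜ X) where
  mul f g := g.trans f
  one := Homeomorph.refl X
  inv := Homeomorph.symm
  mul_assoc _ _ _ := Homeomorph.ext fun _ => rfl
  one_mul _ := Homeomorph.ext fun _ => rfl
  mul_one _ := Homeomorph.ext fun _ => rfl
  inv_mul_cancel f := Homeomorph.ext f.symm_apply_apply

/-- The support of a homeomorphism: the closure of the set of moved points. -/
def Supp {X : Type*} [TopologicalSpace X] (γ : X ≃ₜ X) : Set X :=
  closure {x | γ x ≠ x}

/-- A space has a basis of compact open sets. -/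
def HasCompactOpenBasis (X : Type*) [TopologicalSpace X] : Prop :=
  ∃ B : Set (Set X), (∀ A ∈ B, IsCompact A ∧ IsOpen A) ∧
    TopologicalSpace.IsTopologicalBasis B

/-- Every element of `Γ` has compact open support. -/
def CompactOpenSupports {X : Type*} [TopologicalSpace X] (Γ : Subgroup (X ≃ₜ X)) : Prop :=
  ∀ γ ∈ Γ, IsCompact (Supp γ) ∧ IsOpen (Supp γ)

/-- Condition (F1). -/
def CondF1 {X : Type*} [TopologicalSpace X] (Γ : Subgroup (X ≃ₜ X)) : Prop :=
  ∀ (x : X) (A : Set X), IsClopen A → x ∈ A →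
    ∃ α : X ≃ₜ X, α ∈ Γ ∧ α ≠ 1 ∧ α * α = 1 ∧ x ∈ Supp α ∧ Supp α ⊆ A

/-- Condition (F2). -/
def CondF2 {X : Type*} [TopologicalSpace X] (Γ : Subgroup (X ≃ₜ X)) : Prop :=
  ∀ α : X ≃ₜ X, α ∈ Γ → α ≠ 1 → α * α = 1 →
    ∀ A : Set X, IsClopen A → A.Nonempty → A ⊆ Supp α →
      ∃ β : X ≃ₜ X, β ∈ Γ ∧ β ≠ 1 ∧ Supp β ⊆ A ∪ (⇑α '' A) ∧ ∀ x ∈ Supp β, β x = α x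

/-- Condition (F3). -/
def CondF3 {X : Type*} [TopologicalSpace X] (Γ : Subgroup (X ≃ₜ X)) : Prop :=
  ∀ A : Set X, IsClopen A → A.Nonempty →
    ∃ α : X ≃ₜ X, α ∈ Γ ∧ Supp α ⊆ A ∧ α * α ≠ 1

namespace Recon

open Topology

section Alg
variable {G H : Type*} [Group G] [Group H]

def inU (p f : G) : Prop :=
  f * p = p * f ∧ f * f = 1 ∧ ∀ c : G, c * p = p * c → f * (c * f * c⁻¹) = (c * f * c⁻¹) * f
def inV (p f : G) : Prop := ∀ u : G, inU p u → f * u = u * f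
def inW (p f : G) : Prop := ∀ v : G, inV p v → f * (v * v) = (v * v) * f

lemma inU_map (e : G ≃* H) (p f : G) : inU (e p) (e f) ↔ inU p f := by
  unfold inU
  simp only [e.surjective.forall, ← map_mul, ← map_inv, e.injective.eq_iff, e.map_eq_one_iff]

lemma inV_map (e : G ≃* H) (p f : G) : inV (e p) (e f) ↔ inV p f := by
  unfold inV
  simp only [e.surjective.forall, ← map_mul, e.injective.eq_iff, inU_map]

lemma inW_map (e : G ≃* H) (p f : G) : inW (e p) (e f) ↔ inW p f := by
  unfold inW
  simp only [e.surjective.forall, ← map_mul, e.injective.eq_iff, inV_map]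

end Alg

section Top
variable {X : Type*} [TopologicalSpace X]

lemma mul_app (f g : X ≃ₜ X) (x : X) : (f * g) x = f (g x) := rfl
lemma one_app (x : X) : (1 : X ≃ₜ X) x = x := rfl
lemma inv_app_self (f : X ≃ₜ X) (x : X) : f⁻¹ (f x) = x := f.symm_apply_apply x
lemma app_inv_self (f : X ≃ₜ X) (x : X) : f (f⁻¹ x) = x := f.apply_symm_apply x

lemma fix_of_notMem {f : X ≃ₜ X} {x : X} (h : x ∉ Supp f) : f x = x := by
  by_contra h'
  exact h (subset_closure h')

lemma fix_of_sub {f : X ≃ₜ X} {A : Set X} (h : Supp f ⊆ A) {x : X} (hx : x ∉ A) : f x = x :=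
  fix_of_notMem fun h' => hx (h h')

lemma supp_sub {f : X ≃ₜ X} {A : Set X} (hA : IsClosed A) (h : ∀ x, x ∉ A → f x = x) :
    Supp f ⊆ A := by
  apply closure_minimal _ hA
  intro x hx
  by_contra h'
  exact hx (h x h')

lemma mem_supp_conj (c p : X ≃ₜ X) (x : X) : c x ∈ Supp (c * p * c⁻¹) ↔ x ∈ Supp p := by
  unfold Supp
  rw [← Set.mem_preimage, c.preimage_closure]
  have : c ⁻¹' {x | (c * p * c⁻¹) x ≠ x} = {x | p x ≠ x} := by
    ext y
    simp [mul_app, inv_app_self]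
  rw [this]

lemma mem_supp_comm {c p : X ≃ₜ X} (h : c * p = p * c) (x : X) : c x ∈ Supp p ↔ x ∈ Supp p := by
  have := mem_supp_conj c p x
  rwa [h, mul_inv_cancel_right] at this

lemma supp_eq_empty {p : X ≃ₜ X} : Supp p = ∅ ↔ p = 1 := by
  constructor
  · intro h
    ext x
    rw [fix_of_notMem (by rw [h]; simp)]; rfl
  · rintro rfl
    simp [Supp, one_app]

lemma small [T2Space X] (hX : HasCompactOpenBasis X) {U : Set X} (hU : IsOpen U) {x : X}
    (hx : x ∈ U) : ∃ D : Set X, IsClopen D ∧ x ∈ D ∧ D ⊆ U := by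
  obtain ⟨B, hB, hb⟩ := hX
  obtain ⟨D, hD, hxD, hDU⟩ := hb.exists_subset_of_mem_open hx hU
  exact ⟨D, ⟨(hB D hD).1.isClosed, (hB D hD).2⟩, hxD, hDU⟩

lemma small_move [T2Space X] (hX : HasCompactOpenBasis X) {U : Set X} (hU : IsOpen U) {x : X}
    (hx : x ∈ U) {f : X ≃ₜ X} (hf : f x ≠ x) :
    ∃ D : Set X, IsClopen D ∧ x ∈ D ∧ D ⊆ U ∧ ∀ y ∈ D, f y ∉ D := by
  obtain ⟨u, v, hu, hv, hfu, hxv, huv⟩ := t2_separation hf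
  obtain ⟨D, hD, hxD, hDU⟩ := small hX (U := U ∩ (v ∩ f ⁻¹' u))
    (hU.inter (hv.inter (hu.preimage f.continuous))) ⟨hx, hxv, hfu⟩
  refine ⟨D, hD, hxD, fun y hy => (hDU hy).1, fun y hy hy' => ?_⟩
  exact Set.disjoint_left.1 huv (hDU hy).2.2 (hDU hy').2.1

lemma comm_of_fix {f g : X ≃ₜ X} (h : ∀ x ∈ Supp f, g x = x) : f * g = g * f := by
  ext x
  change f (g x) = g (f x)
  by_cases hx : x ∈ Supp f
  · rw [h x hx, h _ ((mem_supp_comm rfl x).2 hx)]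
  · rw [fix_of_notMem hx]
    apply fix_of_notMem
    intro h'
    have := g.injective (h _ h')
    exact hx (this ▸ h')

lemma eq_one_of_move {f g : X ≃ₜ X} {D : Set X} (hD : ∀ y ∈ D, f y ∉ D) (hg : Supp g ⊆ D)
    (h : f * g = g * f) : g = 1 := by
  ext x
  by_cases hx : x ∈ D
  · have h1 := DFunLike.congr_fun h x
    simp only [mul_app] at h1
    rw [fix_of_sub hg (hD x hx)] at h1
    exact f.injective h1
  · exact fix_of_sub hg hx

lemma U_supp [T2Space X] (hX : HasCompactOpenBasis X) (Γ : Subgroup (X ≃ₜ X))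
    (hco : CompactOpenSupports Γ) (h3 : CondF3 Γ) (p f : Γ) (h : inU p f) :
    Supp (f : X ≃ₜ X) ⊆ Supp (p : X ≃ₜ X) := by
  have hcl := (hco p p.2)
  apply supp_sub hcl.1.isClosed
  intro x hx
  by_contra hfx
  obtain ⟨D, hD, hxD, hDU, hm⟩ := small_move hX hcl.1.isClosed.isOpen_compl hx hfx
  obtain ⟨c, hc, hcD, hc2⟩ := h3 D hD ⟨x, hxD⟩
  have hcp : (⟨c, hc⟩ : Γ) * p = p * ⟨c, hc⟩ := by
    apply Subtype.ext
    exact comm_of_fix fun y hy => fix_of_notMem (hDU (hcD hy))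
  have key := h.2.2 ⟨c, hc⟩ hcp
  have key' : (f : X ≃ₜ X) * (c * f * c⁻¹) = (c * f * c⁻¹) * f := congrArg Subtype.val key
  have hff : (f : X ≃ₜ X) * f = 1 := congrArg Subtype.val h.2.1
  have hff' : ∀ y, (f : X ≃ₜ X) ((f : X ≃ₜ X) y) = y := fun y => DFunLike.congr_fun hff y
  have hfix : ∀ y, y ∉ D → c y = y := fun y hy => fix_of_sub hcD hy
  have hfix' : ∀ y, y ∉ D → c⁻¹ y = y := fun y hy => by
    conv_lhs => rw [← hfix y hy]
    exact inv_app_self c y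
  apply hc2
  ext y
  change c (c y) = y
  by_cases hy : y ∈ D
  · have hw : c⁻¹ y ∈ D := by
      by_contra hw
      have h1 := hfix _ hw
      rw [app_inv_self] at h1
      exact hw (h1 ▸ hy)
    have h1 := DFunLike.congr_fun key' y
    simp only [mul_app] at h1
    rw [hfix _ (hm _ hw), hfix' _ (hm _ hy), hff', hff'] at h1
    rw [← h1, app_inv_self]
  · rw [hfix y hy, hfix y hy]

/-- an element agreeing with `p` on its support belongs to `U`. -/
lemma U_of_agree (Γ : Subgroup (X ≃ₜ X)) (p b : Γ) (hp : p * p = 1)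
    (hb : ∀ x ∈ Supp (b : X ≃ₜ X), (b : X ≃ₜ X) x = (p : X ≃ₜ X) x) : inU p b := by
  obtain ⟨p, hpΓ⟩ := p
  obtain ⟨b, hbΓ⟩ := b
  simp only at hb
  have hpp : p * p = 1 := congrArg Subtype.val hp
  have hpp' : ∀ y, p (p y) = y := fun y => DFunLike.congr_fun hpp y
  have hbS : ∀ x, b x ∈ Supp b ↔ x ∈ Supp b := mem_supp_comm rfl
  have hpS1 : ∀ x, x ∈ Supp b → p x ∈ Supp b := fun x hx => by
    rw [← hb x hx]; exact (hbS x).2 hx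
  have hpS : ∀ x, p x ∈ Supp b ↔ x ∈ Supp b := fun x =>
    ⟨fun hx => by simpa [hpp'] using hpS1 _ hx, hpS1 x⟩
  have hn : ∀ x, x ∉ Supp b → b x = x := fun x hx => fix_of_notMem hx
  refine ⟨Subtype.ext ?_, Subtype.ext ?_, ?_⟩
  · ext x
    change b (p x) = p (b x)
    by_cases hx : x ∈ Supp b
    · rw [hb x hx, hb _ (hpS1 x hx)]
    · rw [hn x hx, hn _ (fun h => hx ((hpS x).1 h))]
  · ext x
    change b (b x) = x
    by_cases hx : x ∈ Supp b
    · rw [hb x hx, hb _ (hpS1 x hx), hpp']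
    · rw [hn x hx, hn x hx]
  · rintro ⟨c, hcΓ⟩ hc
    have hcp : c * p = p * c := congrArg Subtype.val hc
    have hcp' : ∀ y, c (p y) = p (c y) := fun y => DFunLike.congr_fun hcp y
    apply Subtype.ext
    ext x
    obtain ⟨y, rfl⟩ := c.surjective x
    change b (c (b (c⁻¹ (c y)))) = c (b (c⁻¹ (b (c y))))
    rw [inv_app_self]
    have hi : ∀ z, c⁻¹ (p (c z)) = p z := fun z => by rw [← hcp', inv_app_self]
    by_cases hy : y ∈ Supp b <;> by_cases hcy : c y ∈ Supp b
    · rw [hb _ hy, hb _ hcy, hi, hcp', hb _ (hpS1 _ hcy), hb _ (hpS1 _ hy), hcp', hcp']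
    · rw [hb _ hy, hn _ hcy, inv_app_self, hcp', hb _ hy, hcp', hn]
      rwa [hpS]
    · rw [hn _ hy, hb _ hcy, hi, hn, hcp']
      rwa [hpS]
    · rw [hn _ hy, hn _ hcy, inv_app_self, hn _ hy]

lemma V_sq [T2Space X] (hX : HasCompactOpenBasis X) (Γ : Subgroup (X ≃ₜ X))
    (hco : CompactOpenSupports Γ) (h2 : CondF2 Γ) (p f : Γ) (hp : p * p = 1) (h : inV p f)
    (x : X) (hx : x ∈ Supp (p : X ≃ₜ X)) : (f : X ≃ₜ X) ((f : X ≃ₜ X) x) = x := by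
  have hfp := h p (U_of_agree Γ p p hp fun _ _ => rfl)
  have hU : ∀ b (hb : b ∈ Γ), (∀ x ∈ Supp b, b x = (p : X ≃ₜ X) x) →
      (f : X ≃ₜ X) * b = b * f := fun b hb hbp =>
    congrArg Subtype.val (h ⟨b, hb⟩ (U_of_agree Γ p ⟨b, hb⟩ hp hbp))
  obtain ⟨p, hpΓ⟩ := p
  obtain ⟨f, hfΓ⟩ := f
  simp only at hU hx ⊢
  have hpp : p * p = 1 := congrArg Subtype.val hp
  have hpp' : ∀ y, p (p y) = y := fun y => DFunLike.congr_fun hpp y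
  have hfp' : ∀ y, f (p y) = p (f y) := fun y =>
    DFunLike.congr_fun (congrArg Subtype.val hfp : f * p = p * f) y
  by_cases h1 : f x = x
  · rw [h1, h1]
  by_cases h2' : f x = p x
  · rw [h2', hfp', h2', hpp']
  exfalso
  obtain ⟨u, v, hu, hv, hfu, hxv, huv⟩ := t2_separation h1
  obtain ⟨u', v', hu', hv', hfu', hxv', huv'⟩ := t2_separation h2'
  obtain ⟨D, hD, hxD, hDU⟩ := small hX
    (U := Supp p ∩ ((v ∩ f ⁻¹' u) ∩ (p ⁻¹' v' ∩ f ⁻¹' u')))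
    ((hco p hpΓ).2.inter ((hv.inter (hu.preimage f.continuous)).inter
      ((hv'.preimage p.continuous).inter (hu'.preimage f.continuous))))
    ⟨hx, ⟨hxv, hfu⟩, hxv', hfu'⟩
  have m1 : ∀ y ∈ D, f y ∉ D := fun y hy hy' =>
    Set.disjoint_left.1 huv (hDU hy).2.1.2 (hDU hy').2.1.1
  have m2 : ∀ y ∈ D, p (f y) ∉ D := fun y hy hy' =>
    Set.disjoint_left.1 huv' (hDU hy).2.2.2 (by simpa [hpp'] using (hDU hy').2.2.1)
  have hp1 : p ≠ 1 := by
    intro hp1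
    have := supp_eq_empty.2 hp1
    rw [this] at hx
    exact hx
  obtain ⟨b, hbΓ, hb1, hbs, hbp⟩ := h2 p hpΓ hp1 hpp D hD ⟨x, hxD⟩
    (fun y hy => (hDU hy).1)
  apply hb1
  refine eq_one_of_move (f := f) ?_ hbs (hU b hbΓ hbp)
  rintro y (hy | ⟨z, hz, rfl⟩)
  · rintro (h' | ⟨w, hw, hw'⟩)
    · exact m1 y hy h'
    · apply m2 y hy
      rw [← hw', hpp']; exact hw
  · rw [hfp']
    rintro (h' | ⟨w, hw, hw'⟩)
    · exact m2 z hz h'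
    · apply m1 z hz
      rw [← p.injective hw']; exact hw

lemma W_iff [T2Space X] (hX : HasCompactOpenBasis X) (Γ : Subgroup (X ≃ₜ X))
    (hco : CompactOpenSupports Γ) (h2 : CondF2 Γ) (h3 : CondF3 Γ) (p f : Γ) (hp : p * p = 1) :
    inW p f ↔ Supp (f : X ≃ₜ X) ⊆ Supp (p : X ≃ₜ X) := by
  constructor
  · intro h
    have hcl := (hco p p.2)
    apply supp_sub hcl.1.isClosed
    intro x hx
    by_contra hfx
    obtain ⟨D, hD, hxD, hDU, hm⟩ := small_move hX hcl.1.isClosed.isOpen_compl hx hfx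
    obtain ⟨c, hc, hcD, hc2⟩ := h3 D hD ⟨x, hxD⟩
    have hV : inV p ⟨c, hc⟩ := fun u hu => Subtype.ext <|
      comm_of_fix fun y hy => fix_of_sub (U_supp hX Γ hco h3 p u hu) (hDU (hcD hy))
    have hcm : (f : X ≃ₜ X) * (c * c) = (c * c) * f := congrArg Subtype.val (h _ hV)
    refine hc2 (eq_one_of_move hm (supp_sub hD.1 fun y hy => ?_) hcm)
    rw [mul_app, fix_of_sub hcD hy, fix_of_sub hcD hy]
  · intro h v hv
    exact Subtype.ext <| comm_of_fix fun x hx => V_sq hX Γ hco h2 p v hp hv x (h hx)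

end Top

/-- Reconstruction of points. -/
lemma points {I X Y : Type*} [TopologicalSpace X] [TopologicalSpace Y] [T2Space X] [T2Space Y]
    (S : I → Set X) (T : I → Set Y) (hS : ∀ i, IsCompact (S i) ∧ IsOpen (S i))
    (hT : ∀ i, IsCompact (T i) ∧ IsOpen (T i))
    (bS : ∀ x (U : Set X), IsOpen U → x ∈ U → ∃ i, x ∈ S i ∧ S i ⊆ U)
    (bT : ∀ x (U : Set Y), IsOpen U → x ∈ U → ∃ i, x ∈ T i ∧ T i ⊆ U)
    (hsub : ∀ i j, S i ⊆ S j ↔ T i ⊆ T j) (hemp : ∀ i, S i = ∅ ↔ T i = ∅) (x : X) :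
    ∃ y, ∀ i, x ∈ S i ↔ y ∈ T i := by
  have hne : ∀ i, x ∈ S i → (T i).Nonempty := fun i hi => by
    rw [Set.nonempty_iff_ne_empty, Ne, ← hemp]
    rintro h
    rw [h] at hi; exact hi
  obtain ⟨i₀, hi₀, -⟩ := bS x Set.univ isOpen_univ trivial
  haveI : Nonempty {i // x ∈ S i} := ⟨⟨i₀, hi₀⟩⟩
  have hd : Directed (· ⊇ ·) (fun i : {i // x ∈ S i} => T i) := by
    rintro ⟨i, hi⟩ ⟨j, hj⟩
    obtain ⟨k, hk, hks⟩ := bS x (S i ∩ S j) ((hS i).2.inter (hS j).2) ⟨hi, hj⟩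
    exact ⟨⟨k, hk⟩, (hsub k i).1 (fun z hz => (hks hz).1), (hsub k j).1 (fun z hz => (hks hz).2)⟩
  obtain ⟨y, hy⟩ := IsCompact.nonempty_iInter_of_directed_nonempty_isCompact_isClosed _ hd
    (fun i => hne i i.2) (fun i => (hT i).1) (fun i => (hT i).1.isClosed)
  rw [Set.mem_iInter] at hy
  refine ⟨y, fun j => ⟨fun hj => hy ⟨j, hj⟩, fun hj => ?_⟩⟩
  by_contra hx
  obtain ⟨i, hi, his⟩ := bS x (S j)ᶜ (hS j).1.isClosed.isOpen_compl hx
  obtain ⟨k, hk, hks⟩ := bT y (T i ∩ T j) ((hT i).2.inter (hT j).2) ⟨hy ⟨i, hi⟩, hj⟩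
  have h1 := (hsub k i).2 (fun z hz => (hks hz).1)
  have h2 := (hsub k j).2 (fun z hz => (hks hz).2)
  have h3 : S k = ∅ := by
    ext z
    simp only [Set.mem_empty_iff_false, iff_false]
    exact fun hz => his (h1 hz) (h2 hz)
  rw [(hemp k).1 h3] at hk
  exact hk

lemma sep_eq {I Y : Type*} [TopologicalSpace Y] [T2Space Y] (T : I → Set Y)
    (bT : ∀ x (U : Set Y), IsOpen U → x ∈ U → ∃ i, x ∈ T i ∧ T i ⊆ U) {y z : Y}
    (h : ∀ i, y ∈ T i ↔ z ∈ T i) : y = z := by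
  by_contra hne
  obtain ⟨i, hi, his⟩ := bT y {z}ᶜ isOpen_compl_singleton hne
  exact his ((h i).1 hi) rfl

lemma cont {I X Y : Type*} [TopologicalSpace X] [TopologicalSpace Y]
    (S : I → Set X) (T : I → Set Y) (hS : ∀ i, IsCompact (S i) ∧ IsOpen (S i))
    (bT : ∀ x (U : Set Y), IsOpen U → x ∈ U → ∃ i, x ∈ T i ∧ T i ⊆ U)
    (φ : X → Y) (h : ∀ x i, x ∈ S i ↔ φ x ∈ T i) : Continuous φ := by
  rw [continuous_iff_continuousAt]
  intro x U hU
  obtain ⟨V, hVU, hV, hxV⟩ := mem_nhds_iff.1 hU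
  obtain ⟨i, hi, hiV⟩ := bT _ V hV hxV
  rw [Filter.mem_map]
  exact Filter.mem_of_superset ((hS i).2.mem_nhds ((h x i).2 hi))
    fun z hz => hVU (hiV ((h z i).1 hz))

lemma homeo {I X Y : Type*} [TopologicalSpace X] [TopologicalSpace Y] [T2Space X] [T2Space Y]
    (S : I → Set X) (T : I → Set Y) (hS : ∀ i, IsCompact (S i) ∧ IsOpen (S i))
    (hT : ∀ i, IsCompact (T i) ∧ IsOpen (T i))
    (bS : ∀ x (U : Set X), IsOpen U → x ∈ U → ∃ i, x ∈ S i ∧ S i ⊆ U)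
    (bT : ∀ x (U : Set Y), IsOpen U → x ∈ U → ∃ i, x ∈ T i ∧ T i ⊆ U)
    (hsub : ∀ i j, S i ⊆ S j ↔ T i ⊆ T j) (hemp : ∀ i, S i = ∅ ↔ T i = ∅) :
    ∃ φ : X ≃ₜ Y, ∀ x i, x ∈ S i ↔ φ x ∈ T i := by
  choose f hf using points S T hS hT bS bT hsub hemp
  choose g hg using points T S hT hS bT bS (fun i j => (hsub i j).symm) (fun i => (hemp i).symm)
  exact ⟨{ toFun := f
           invFun := g
           left_inv := fun x => sep_eq S bS fun i => by rw [hf x i, hg]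
           right_inv := fun x => sep_eq T bT fun i => by rw [hg x i, hf]
           continuous_toFun := cont S T hS bT f hf
           continuous_invFun := cont T S hT bS g hg }, hf⟩

lemma basis {X : Type*} [TopologicalSpace X] [T2Space X] (hX : HasCompactOpenBasis X)
    (Γ : Subgroup (X ≃ₜ X)) (h1 : CondF1 Γ) (x : X) (U : Set X) (hU : IsOpen U) (hx : x ∈ U) :
    ∃ i : Γ, i * i = 1 ∧ x ∈ Supp (i : X ≃ₜ X) ∧ Supp (i : X ≃ₜ X) ⊆ U := by
  obtain ⟨D, hD, hxD, hDU⟩ := small hX hU hx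
  obtain ⟨a, ha, -, haa, hxa, haD⟩ := h1 x D hD hxD
  exact ⟨⟨a, ha⟩, Subtype.ext haa, hxa, haD.trans hDU⟩

end Recon

/-- If `(Γ₁, X₁)` and `(Γ₂, X₂)` are pairs of Boolean spaces together with
groups of homeomorphisms whose elements all have compact open support, and both pairs
satisfy conditions (F1), (F2) and (F3), then every abstract group isomorphism
`Φ : Γ₁ → Γ₂` is spatially implemented. -/
theorem statement0 {X₁ X₂ : Type*} [TopologicalSpace X₁] [TopologicalSpace X₂]
    [T2Space X₁] [T2Space X₂]
    (hX₁ : HasCompactOpenBasis X₁) (hX₂ : HasCompactOpenBasis X₂)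
    (Γ₁ : Subgroup (X₁ ≃ₜ X₁)) (Γ₂ : Subgroup (X₂ ≃ₜ X₂))
    (hco₁ : CompactOpenSupports Γ₁) (hco₂ : CompactOpenSupports Γ₂)
    (hF₁ : CondF1 Γ₁ ∧ CondF2 Γ₁ ∧ CondF3 Γ₁)
    (hF₂ : CondF1 Γ₂ ∧ CondF2 Γ₂ ∧ CondF3 Γ₂)
    (Φ : Γ₁ ≃* Γ₂) :
    ∃ φ : X₁ ≃ₜ X₂, ∀ γ : Γ₁,
      ⇑((Φ γ : Γ₂) : X₂ ≃ₜ X₂) = ⇑φ ∘ ⇑((γ : Γ₁) : X₁ ≃ₜ X₁) ∘ ⇑φ.symm := by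
  classical
  obtain ⟨a1, a2, a3⟩ := hF₁
  obtain ⟨b1, b2, b3⟩ := hF₂
  have hΦ : ∀ i : Γ₁, i * i = 1 → Φ i * Φ i = 1 := fun i hi => by
    rw [← map_mul, hi, map_one]
  obtain ⟨φ, hφ⟩ := Recon.homeo (I := {i : Γ₁ // i * i = 1})
    (fun i => Supp ((i : Γ₁) : X₁ ≃ₜ X₁)) (fun i => Supp ((Φ i : Γ₂) : X₂ ≃ₜ X₂))
    (fun i => hco₁ _ i.1.2) (fun i => hco₂ _ (Φ i).2)
    (fun x U hU hx => by
      obtain ⟨i, hi, h⟩ := Recon.basis hX₁ Γ₁ a1 x U hU hx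
      exact ⟨⟨i, hi⟩, h⟩)
    (fun x U hU hx => by
      obtain ⟨i, hi, h⟩ := Recon.basis hX₂ Γ₂ b1 x U hU hx
      refine ⟨⟨Φ.symm i, ?_⟩, ?_⟩
      · rw [← map_mul, hi, map_one]
      · simpa using h)
    (fun i j => by
      rw [← Recon.W_iff hX₁ Γ₁ hco₁ a2 a3 j.1 i.1 j.2,
        ← Recon.W_iff hX₂ Γ₂ hco₂ b2 b3 (Φ j.1) (Φ i.1) (hΦ _ j.2), Recon.inW_map])
    (fun i => by
      simp only [Recon.supp_eq_empty, OneMemClass.coe_eq_one, EmbeddingLike.map_eq_one_iff])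
  refine ⟨φ, fun γ => ?_⟩
  have key : ∀ x, φ ((γ : X₁ ≃ₜ X₁) x) = ((Φ γ : Γ₂) : X₂ ≃ₜ X₂) (φ x) := by
    intro x
    refine Recon.sep_eq (fun i : {i : Γ₁ // i * i = 1} => Supp ((Φ i : Γ₂) : X₂ ≃ₜ X₂))
      (fun x U hU hx => by
        obtain ⟨i, hi, h⟩ := Recon.basis hX₂ Γ₂ b1 x U hU hx
        refine ⟨⟨Φ.symm i, ?_⟩, ?_⟩
        · rw [← map_mul, hi, map_one]
        · simpa using h) fun i => ?_
    obtain ⟨i, hi⟩ := i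
    obtain ⟨j, rfl⟩ : ∃ j, γ * j * γ⁻¹ = i := ⟨γ⁻¹ * i * γ, by group⟩
    have hj : j * j = 1 := by
      have : γ * (j * j) * γ⁻¹ = 1 := by rw [← hi]; group
      simpa [mul_inv_eq_one] using this
    rw [← hφ]
    have e1 := Recon.mem_supp_conj (γ : X₁ ≃ₜ X₁) j x
    have e2 := Recon.mem_supp_conj ((Φ γ : Γ₂) : X₂ ≃ₜ X₂) (Φ j : Γ₂) (φ x)
    have e3 := hφ x ⟨j, hj⟩
    simp only [map_mul, map_inv, Subgroup.coe_mul, Subgroup.coe_inv] at e3 ⊢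
    rw [e1, e2, e3]
  funext y
  change _ = φ ((γ : X₁ ≃ₜ X₁) (φ.symm y))
  rw [key, φ.apply_symm_apply]
end

section
/- Let X₁ and X₂ be locally compact Cantor spaces, and for i = 1,2 let Γᵢ be a subgroup of the group of homeomorphisms of Xᵢ such that every element of Γᵢ has compact open support. Assume for i = 1,2 that (Γᵢ, Xᵢ) is locally moving and locally flexible, that every clopen subset of Xᵢ is recognizable by Γᵢ, and that every Γᵢ-orbit contains at least 3 points. Then every abstract group isomorphism Φ : Γ₁ → Γ₂ is spatially implemented: there exists a homeomorphism φ : X₁ → X₂ such that Φ(γ) = φ ∘ γ ∘ φ⁻¹ for every γ ∈ Γ₁. -/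
/-- `(Γ, X)` is locally moving. -/
def LocallyMoving {X : Type*} [TopologicalSpace X] (Γ : Subgroup (X ≃ₜ X)) : Prop :=
  ∀ A : Set X, IsOpen A → A.Nonempty → ∃ γ : X ≃ₜ X, γ ∈ Γ ∧ γ ≠ 1 ∧ Supp γ ⊆ A

/-- An open set `B` is flexible for `Γ`. -/
def FlexibleSet {X : Type*} [TopologicalSpace X] (Γ : Subgroup (X ≃ₜ X)) (B : Set X) : Prop :=
  ∀ C₁ C₂ : Set X, IsOpen C₁ → IsOpen C₂ → C₁ ⊆ B → C₂ ⊆ B →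
    (∃ γ : X ≃ₜ X, γ ∈ Γ ∧ ((⇑γ '' C₁) ∩ C₂).Nonempty) →
    ∃ τ : X ≃ₜ X, τ ∈ Γ ∧ ((⇑τ '' C₁) ∩ C₂).Nonempty ∧ Supp τ ⊆ B

/-- `(Γ, X)` is locally flexible. -/
def LocallyFlexible {X : Type*} [TopologicalSpace X] (Γ : Subgroup (X ≃ₜ X)) : Prop :=
  ∀ A : Set X, IsOpen A → A.Nonempty →
    ∃ B : Set X, B ⊆ A ∧ IsOpen B ∧ B.Nonempty ∧ FlexibleSet Γ B

/-- A clopen set `A` is recognizable by `Γ`. -/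
def RecognizableBy {X : Type*} [TopologicalSpace X] (Γ : Subgroup (X ≃ₜ X)) (A : Set X) :
    Prop :=
  (∀ γ : X ≃ₜ X, γ ∈ Γ → ⇑γ '' A = A →
    ∃ τ : X ≃ₜ X, τ ∈ Γ ∧ (∀ x ∈ A, τ x = γ x) ∧ ∀ x ∉ A, τ x = x) ∧
  (∀ γ : X ≃ₜ X, γ ∈ Γ → (⇑γ '' A) ∩ A = ∅ →
    ∃ τ : X ≃ₜ X, τ ∈ Γ ∧ (∀ x ∈ A, τ x = γ x) ∧ (∀ x ∈ ⇑γ '' A, τ x = γ.symm x) ∧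
      ∀ x, x ∉ A → x ∉ ⇑γ '' A → τ x = x)

/-- Every `Γ`-orbit contains at least 3 points. -/
def OrbitAtLeastThree {X : Type*} [TopologicalSpace X] (Γ : Subgroup (X ≃ₜ X)) : Prop :=
  ∀ x : X, ∃ γ₁ γ₂ γ₃ : X ≃ₜ X, γ₁ ∈ Γ ∧ γ₂ ∈ Γ ∧ γ₃ ∈ Γ ∧
    γ₁ x ≠ γ₂ x ∧ γ₁ x ≠ γ₃ x ∧ γ₂ x ≠ γ₃ x

namespace Rub
set_option linter.unusedSectionVars false

/-- algebraic disjointness -/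
def AD {G : Type*} [Group G] (g f : G) : Prop :=
  ∀ h : G, f * h ≠ h * f → ∃ f1 f2 : G, Commute f1 g ∧ Commute f2 g ∧
    f1 * (f2 * h * f2⁻¹ * h⁻¹) * f1⁻¹ * (f2 * h * f2⁻¹ * h⁻¹)⁻¹ ≠ 1 ∧
    Commute (f1 * (f2 * h * f2⁻¹ * h⁻¹) * f1⁻¹ * (f2 * h * f2⁻¹ * h⁻¹)⁻¹) g

/-- algebraic support inclusion -/
def Sb {G : Type*} [Group G] (k f : G) : Prop := ∀ g : G, AD g f → Commute k (g ^ 12)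

lemma AD.map {G H : Type*} [Group G] [Group H] (Φ : G ≃* H) {g f : G} (h : AD g f) :
    AD (Φ g) (Φ f) := by
  intro k hk
  obtain ⟨k, rfl⟩ := Φ.surjective k
  obtain ⟨f1, f2, h1, h2, h3, h4⟩ := h k (by
    intro e; apply hk; rw [← map_mul, e, map_mul])
  refine ⟨Φ f1, Φ f2, h1.map Φ, h2.map Φ, ?_, ?_⟩
  · simpa only [← map_mul, ← map_inv, ne_eq, map_eq_one_iff Φ Φ.injective] using h3
  · simpa only [← map_mul, ← map_inv] using h4.map Φ

lemma Sb.map {G H : Type*} [Group G] [Group H] (Φ : G ≃* H) {k f : G} (h : Sb k f) :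
    Sb (Φ k) (Φ f) := by
  intro g hg
  obtain ⟨g, rfl⟩ := Φ.surjective g
  have := hg.map Φ.symm
  simp only [MulEquiv.symm_apply_apply] at this
  rw [← map_pow]
  exact (h g this).map Φ

section
variable {G X : Type*} [Group G] [TopologicalSpace X] [T2Space X] [MulAction G X]
  [FaithfulSMul G X] [ContinuousConstSMul G X]

/-- moved set -/
def M (X : Type*) {G : Type*} [Group G] [MulAction G X] (g : G) : Set X := {x | g • x ≠ x}

lemma isOpen_M (g : G) : IsOpen (M X g) :=
  isOpen_ne_fun (continuous_const_smul g) continuous_id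

lemma M_ne (g : G) (h : g ≠ 1) : ∃ x : X, g • x ≠ x := by
  by_contra hc
  push Not at hc
  exact h (FaithfulSMul.eq_of_smul_eq_smul (α := X) (by simpa using hc))

lemma comm_of_disj {f g : G} (h : Disjoint (M X f) (M X g)) : Commute f g := by
  apply FaithfulSMul.eq_of_smul_eq_smul (α := X)
  intro x
  rw [Set.disjoint_left] at h
  simp only [M, Set.mem_setOf_eq, not_not] at h
  rw [mul_smul, mul_smul]
  by_cases hf : f • x = x
  · rw [hf]
    by_contra hc
    have := h hc
    rw [smul_left_cancel_iff] at this
    rw [this, hf] at hc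
    exact hc rfl
  · have h1 := h hf
    rw [h1]
    have : f • (f • x) ≠ f • x := by rwa [ne_eq, smul_left_cancel_iff]
    rw [h this]

lemma moved_comm {f g : G} (h : Commute f g) {x : X} (hx : f • x ≠ x) : f • g • x ≠ g • x := by
  rw [← mul_smul, h.eq, mul_smul]
  rwa [ne_eq, smul_left_cancel_iff]

/-- finite avoiding neighbourhood -/
lemma nbhd (s : Finset G) (x : X) (hx : ∀ g ∈ s, g • x ≠ x) :
    ∃ V : Set X, IsOpen V ∧ x ∈ V ∧ ∀ g ∈ s, ∀ y ∈ V, g • y ∉ V := by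
  classical
  induction s using Finset.induction_on with
  | empty => exact ⟨Set.univ, isOpen_univ, trivial, by simp⟩
  | insert a s ha ih =>
    obtain ⟨V, hV, hxV, h⟩ := ih (fun g hg => hx g (Finset.mem_insert_of_mem hg))
    obtain ⟨P, Q, hP, hQ, hxP, hxQ, hd⟩ := t2_separation (hx a (Finset.mem_insert_self _ _))
    refine ⟨V ∩ Q ∩ (fun y => a • y) ⁻¹' P,
      (hV.inter hQ).inter (hP.preimage (continuous_const_smul a)), ⟨⟨hxV, hxQ⟩, hxP⟩, ?_⟩
    intro g hg y hy hy'
    rcases Finset.mem_insert.1 hg with rfl | hg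
    · exact Set.disjoint_left.1 hd hy.2 hy'.1.2
    · exact h g hg y hy.1.1 hy'.1.1

/-- locally moving -/
def LM (G X : Type*) [Group G] [TopologicalSpace X] [MulAction G X] : Prop :=
  ∀ U : Set X, IsOpen U → U.Nonempty → ∃ g : G, g ≠ 1 ∧ M X g ⊆ U

lemma smul_mem {g : G} {U : Set X} (h : M X g ⊆ U) {x : X} (hx : x ∈ U) : g • x ∈ U := by
  by_cases e : g • x = x
  · rwa [e]
  · apply h; change g • g • x ≠ g • x; rwa [ne_eq, smul_left_cancel_iff]

lemma exp_aux (hlm : LM G X) (U : Set X) (hU : IsOpen U) (hne : U.Nonempty) (n : ℕ) :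
    ∃ g : G, M X g ⊆ U ∧ ∃ x ∈ U, ∀ i, 1 ≤ i → i ≤ n → g ^ i • x ≠ x := by
  classical
  induction n with
  | zero =>
    obtain ⟨x, hx⟩ := hne
    exact ⟨1, by intro x hx; simp [M] at hx, x, hx, by intro i h1 h2; omega⟩
  | succ n ih =>
    obtain ⟨g, hg, x, hx, hi⟩ := ih
    obtain ⟨V, hV, hxV, hVd⟩ := nbhd ((Finset.Icc 1 n).image (fun i => g ^ i)) x (by
      intro k hk
      obtain ⟨i, hi', rfl⟩ := Finset.mem_image.1 hk
      rw [Finset.mem_Icc] at hi'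
      exact hi i hi'.1 hi'.2)
    have hVd' : ∀ i, 1 ≤ i → i ≤ n → ∀ y ∈ V, g ^ i • y ∉ V := by
      intro i h1 h2
      exact hVd _ (Finset.mem_image.2 ⟨i, Finset.mem_Icc.2 ⟨h1, h2⟩, rfl⟩)
    by_cases hex : ∃ y ∈ V ∩ U, g ^ (n+1) • y ≠ y
    · obtain ⟨y, hy, hy'⟩ := hex
      refine ⟨g, hg, y, hy.2, ?_⟩
      intro i h1 h2
      by_cases e : i = n + 1
      · rwa [e]
      · intro e'
        apply hVd' i h1 (by omega) y hy.1
        rw [e']; exact hy.1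
    · push Not at hex
      obtain ⟨h, h1, hh⟩ := hlm (V ∩ U) (hV.inter hU) ⟨x, hxV, hx⟩
      obtain ⟨y, hy⟩ := M_ne (X := X) h h1
      have hyV : y ∈ V ∩ U := hh hy
      have hhy : h • y ∈ V ∩ U := smul_mem hh hyV
      have key : ∀ i, 1 ≤ i → i ≤ n + 1 → (g * h) ^ i • y = g ^ i • h • y := by
        intro i h1 h2
        induction i, h1 using Nat.le_induction with
        | base => simp [mul_smul]
        | succ i hi ih =>
          rw [pow_succ', mul_smul, ih (by omega), mul_smul, pow_succ', mul_smul]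
          congr 1
          by_contra hc
          exact hVd' i hi (by omega) _ hhy.1 (hh hc).1
      refine ⟨g * h, ?_, y, hyV.2, ?_⟩
      · intro z hz
        by_contra hzU
        apply hz
        have e1 : h • z = z := by by_contra hc; exact hzU (hh hc).2
        have e2 : g • z = z := by by_contra hc; exact hzU (hg hc)
        rw [mul_smul, e1, e2]
      · intro i h1 h2
        rw [key i h1 h2]
        by_cases e : i = n + 1
        · rw [e, hex _ hhy]; exact hy
        · intro e'
          apply hVd' i h1 (by omega) _ hhy.1
          rw [e']; exact hyV.1

lemma AD_of_disj (hlm : LM G X) {f g : G} (hd : Disjoint (M X f) (M X g)) : AD g f := by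
  classical
  intro h hfh
  have : ∃ x, x ∈ M X f ∧ x ∈ M X h := by
    by_contra hc
    push Not at hc
    exact hfh (comm_of_disj (X := X) (Set.disjoint_left.2 hc))
  obtain ⟨x, hxf, hxh⟩ := this
  obtain ⟨V, hV, hxV, hVd⟩ := nbhd {h} x (fun g hg => by rw [Finset.mem_singleton.1 hg]; exact hxh)
  have hVd : ∀ y ∈ V, h • y ∉ V := hVd h (by simp)
  obtain ⟨f2, h2, hf2⟩ := hlm (V ∩ M X f) (hV.inter (isOpen_M f)) ⟨x, hxV, hxf⟩
  obtain ⟨z, hz⟩ := M_ne (X := X) f2 h2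
  obtain ⟨W, hW, hzW, hWd⟩ := nbhd {f2} z (by simpa using hz)
  have hWd : ∀ y ∈ W, f2 • y ∉ W := hWd f2 (by simp)
  obtain ⟨f1, h1, hf1⟩ := hlm (W ∩ (V ∩ M X f)) (hW.inter (hV.inter (isOpen_M f)))
    ⟨z, hzW, hf2 hz⟩
  have hg : ∀ k : G, M X k ⊆ M X f → Commute k g := fun k hk =>
    comm_of_disj (X := X) (hd.mono_left hk)
  have f1fix : ∀ y, y ∉ W ∩ (V ∩ M X f) → f1⁻¹ • y = y := by
    intro y hy
    rw [inv_smul_eq_iff]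
    by_contra hc; exact hy (hf1 (Ne.symm hc))
  have f2fix : ∀ y, y ∉ V ∩ M X f → f2⁻¹ • y = y := by
    intro y hy
    rw [inv_smul_eq_iff]
    by_contra hc; exact hy (hf2 (Ne.symm hc))
  set k := f2 * h * f2⁻¹ * h⁻¹ with hk
  -- k⁻¹ on V equals f2⁻¹
  have kinv : ∀ y ∈ V, k⁻¹ • y = f2⁻¹ • y := by
    intro y hy
    have : k⁻¹ = h * f2 * h⁻¹ * f2⁻¹ := by rw [hk]; group
    rw [this]
    simp only [mul_smul]
    have hy2 : f2⁻¹ • y ∈ V := by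
      by_cases e : y ∈ V ∩ M X f
      · have : M X f2⁻¹ ⊆ V ∩ M X f := by
          intro w hw; by_contra hc; exact hw (f2fix w hc)
        exact (smul_mem this e).1
      · rw [f2fix y e]; exact hy
    have : f2 • h⁻¹ • f2⁻¹ • y = h⁻¹ • f2⁻¹ • y := by
      by_contra hc
      have := (hf2 hc).1
      apply hVd _ this
      rwa [smul_inv_smul]
    rw [this, smul_inv_smul]
  have hsub : M X (f1 * k * f1⁻¹ * k⁻¹) ⊆ V ∩ M X f := by
    intro y hy
    by_contra hc
    apply hy
    have : f1⁻¹ • k⁻¹ • y = k⁻¹ • y := by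
      by_cases hyV : y ∈ V
      · rw [kinv y hyV, f2fix y hc, f1fix y (fun h => hc h.2)]
      · apply f1fix
        intro hin
        -- k⁻¹ y in V; then y = k (k⁻¹ y)
        have hw : k⁻¹ • y ∈ V ∩ M X f := hin.2
        set w := k⁻¹ • y with hwdef
        have hyw : y = k • w := by rw [hwdef, smul_inv_smul]
        have h3 : f2 • w ∈ V ∩ M X f := smul_mem hf2 hw
        have h4 := kinv _ h3.1
        rw [inv_smul_smul, inv_smul_eq_iff, ← hyw] at h4
        rw [h4] at h3
        exact hc h3
    simp only [mul_smul]
    rw [this, smul_inv_smul]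
    by_contra hc'
    exact hc (hf1 hc').2
  refine ⟨f1, f2, hg f1 (fun y hy => (hf1 hy).2.2), hg f2 (fun y hy => (hf2 hy).2), ?_,
    hg _ (fun y hy => (hsub hy).2)⟩
  intro e
  obtain ⟨y, hy⟩ := M_ne (X := X) f1 h1
  have hyW := hf1 hy
  have e2 : (f1 * k * f1⁻¹ * k⁻¹) • y = y := by rw [e, one_smul]
  simp only [mul_smul] at e2
  rw [kinv y hyW.2.1, f1fix (f2⁻¹ • y), ← kinv y hyW.2.1, smul_inv_smul] at e2
  · exact hy e2
  · intro hc
    apply hWd _ hc.1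
    rw [smul_inv_smul]; exact hyW.1

lemma disj_of_AD (hlm : LM G X) {f g : G} (had : AD g f) :
    Disjoint (M X f) (M X (g ^ 12)) := by
  classical
  rw [Set.disjoint_left]
  intro x hxf hxg
  have hgi : ∀ i, 1 ≤ i → i ≤ 4 → g ^ i • x ≠ x := by
    have hp : ∀ i j, g ^ i • x = x → g ^ (i * j) • x = x := by
      intro i j hi
      induction j with
      | zero => simp
      | succ j ih => rw [Nat.mul_succ, pow_add, mul_smul, hi, ih]
    intro i h1 h2 e
    apply hxg
    interval_cases i
    · exact hp 1 12 e
    · exact hp 2 6 e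
    · exact hp 3 4 e
    · exact hp 4 3 e
  obtain ⟨U, hU, hxU, hUd⟩ := nbhd (insert f ((Finset.Icc 1 4).image (fun i => g ^ i))) x (by
    intro k hk
    rcases Finset.mem_insert.1 hk with rfl | hk
    · exact hxf
    obtain ⟨i, hi', rfl⟩ := Finset.mem_image.1 hk
    rw [Finset.mem_Icc] at hi'
    exact hgi i hi'.1 hi'.2)
  have hUf : ∀ y ∈ U, f • y ∉ U := hUd f (Finset.mem_insert_self _ _)
  have hUg : ∀ i, 1 ≤ i → i ≤ 4 → ∀ y ∈ U, g ^ i • y ∉ U := by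
    intro i h1 h2
    exact hUd _ (Finset.mem_insert_of_mem
      (Finset.mem_image.2 ⟨i, Finset.mem_Icc.2 ⟨h1, h2⟩, rfl⟩))
  obtain ⟨h, h1, hh⟩ := hlm U hU ⟨x, hxU⟩
  obtain ⟨f1, f2, c1, c2, hne, hc⟩ := had h (by
    intro e
    obtain ⟨y, hy⟩ := M_ne (X := X) h h1
    have e2 : (f * h) • y = (h * f) • y := by rw [e]
    rw [mul_smul, mul_smul] at e2
    have : h • f • y = f • y := by
      by_contra hc
      exact hUf y (hh hy) (hh hc)
    rw [this, smul_left_cancel_iff] at e2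
    exact hy e2)
  set k := f1 * (f2 * h * f2⁻¹ * h⁻¹) * f1⁻¹ * (f2 * h * f2⁻¹ * h⁻¹)⁻¹ with hk
  obtain ⟨p, hp⟩ := M_ne (X := X) k hne
  have hfix : ∀ y, y ∉ U → h • y = y := fun y hy => by by_contra hc; exact hy (hh hc)
  have hfix' : ∀ y, y ∉ U → h⁻¹ • y = y := fun y hy => by
    rw [inv_smul_eq_iff, hfix y hy]
  let E : Fin 4 → G := ![1, f1, f2, f1 * f2]
  have hE : ∀ a, Commute (E a) g := by
    intro a
    fin_cases a
    · exact Commute.one_left g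
    · exact c1
    · exact c2
    · exact c1.mul_left c2
  have hcov : ∀ q : X, k • q ≠ q → ∃ a, (E a)⁻¹ • q ∈ U := by
    intro q hq
    by_contra hno
    push Not at hno
    have n0 : q ∉ U := by have := hno 0; simpa [E] using this
    have n1 : f1⁻¹ • q ∉ U := hno 1
    have n2 : f2⁻¹ • q ∉ U := hno 2
    have n3 : f2⁻¹ • f1⁻¹ • q ∉ U := by
      have := hno 3; simpa [E, mul_smul] using this
    apply hq
    have hk' : k = f1 * f2 * h * f2⁻¹ * h⁻¹ * f1⁻¹ * h * f2 * h⁻¹ * f2⁻¹ := by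
      rw [hk]; group
    rw [hk']
    simp only [mul_smul]
    rw [hfix' _ n2, smul_inv_smul, hfix _ n0, hfix' _ n1, hfix _ n3, smul_inv_smul, smul_inv_smul]
  have hm : ∀ i : Fin 5, ∃ a, (E a)⁻¹ • g ^ (i : ℕ) • p ∈ U := by
    intro i
    exact hcov _ (moved_comm (hc.pow_right _) hp)
  choose c hcU using hm
  obtain ⟨i, j, hij, hcij⟩ := Fintype.exists_ne_map_eq_of_card_lt c (by simp)
  wlog hlt : i < j generalizing i j
  · exact this j i hij.symm hcij.symm (lt_of_le_of_ne (not_lt.1 hlt) hij.symm)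
  have hi := hcU i
  have hj := hcU j
  rw [← hcij] at hj
  apply hUg (j - i) (by omega) (by omega) _ hi
  have : g ^ ((j:ℕ) - i) • (E (c i))⁻¹ • g ^ (i:ℕ) • p = (E (c i))⁻¹ • g ^ (j:ℕ) • p := by
    have cc : Commute (E (c i))⁻¹ (g ^ ((j:ℕ) - i)) := ((hE (c i)).pow_right _).inv_left
    rw [← mul_smul, ← cc.eq, mul_smul, ← mul_smul (g ^ ((j:ℕ) - i)), ← pow_add]
    congr 3
    omega
  rwa [this]

lemma Sb_iff (hlm : LM G X) {k f : G} : Sb k f ↔ M X k ⊆ closure (M X f) := by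
  classical
  constructor
  · intro h x hx
    by_contra hxf
    obtain ⟨V, hV, hxV, hVd⟩ := nbhd {k} x (fun g hg => by rw [Finset.mem_singleton.1 hg]; exact hx)
    have hVd : ∀ y ∈ V, k • y ∉ V := hVd k (by simp)
    obtain ⟨g, hg, y, hyU, hy⟩ := exp_aux (G := G) hlm (V ∩ (closure (M X f))ᶜ)
      (hV.inter isClosed_closure.isOpen_compl) ⟨x, hxV, hxf⟩ 12
    have had : AD g f := AD_of_disj (X := X) hlm (by
      rw [Set.disjoint_left]
      intro z hz hz'
      exact (hg hz').2 (subset_closure hz))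
    have hcm := h g had
    have hy12 := hy 12 (by norm_num) le_rfl
    have : g ^ 12 • k • y ≠ k • y := moved_comm hcm.symm hy12
    apply this
    have hfx : g • k • y = k • y := by
      by_contra hc
      exact hVd y hyU.1 (hg hc).1
    have : g ∈ MulAction.stabilizer G (k • y) := hfx
    exact pow_mem this 12
  · intro h g hg
    apply comm_of_disj (X := X)
    have := (disj_of_AD (X := X) hlm hg).closure_left (isOpen_M _)
    exact this.mono_left h

end

section
variable {G H X Y : Type*} [Group G] [Group H] [TopologicalSpace X] [T2Space X]
  [TopologicalSpace Y] [T2Space Y] [MulAction G X] [MulAction H Y]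
  [FaithfulSMul G X] [ContinuousConstSMul G X] [FaithfulSMul H Y] [ContinuousConstSMul H Y]

/-- closed support -/
def S (X : Type*) {G : Type*} [TopologicalSpace X] [Group G] [MulAction G X] (g : G) : Set X :=
  closure (M X g)

/-- the package of hypotheses used -/
structure Good (G X : Type*) [Group G] [TopologicalSpace X] [MulAction G X] : Prop where
  lm : LM G X
  cpt : ∀ g : G, IsCompact (S X g)
  opn : ∀ g : G, IsOpen (S X g)
  sub : ∀ (x : X) (U : Set X), IsOpen U → x ∈ U →
    ∃ f f' : G, x ∈ S X f ∧ x ∈ S X f' ∧ S X f ∩ S X f' ⊆ U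

lemma S_sub_iff (hG : Good G X) {k f : G} : Sb k f ↔ S X k ⊆ S X f := by
  rw [Sb_iff (X := X) hG.lm]
  exact ⟨fun h => closure_minimal h isClosed_closure, fun h => subset_closure.trans h⟩

lemma S_sub_map (hG : Good G X) (hH : Good H Y) (Φ : G ≃* H) {k f : G} (h : S X k ⊆ S X f) :
    S Y (Φ k) ⊆ S Y (Φ f) :=
  (S_sub_iff hH).1 (((S_sub_iff hG).2 h).map Φ)

lemma LM.exists (hG : Good G X) {U : Set X} (hU : IsOpen U) (hne : U.Nonempty) :
    ∃ g : G, g ≠ 1 ∧ S X g ⊆ U := by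
  obtain ⟨x, hx⟩ := hne
  obtain ⟨f, f', h1, h2, h3⟩ := hG.sub x U hU hx
  obtain ⟨g, hg1, hg⟩ := hG.lm (S X f ∩ S X f') ((hG.opn f).inter (hG.opn f')) ⟨x, h1, h2⟩
  exact ⟨g, hg1, (closure_minimal hg (isClosed_closure.inter isClosed_closure)).trans h3⟩

lemma S_disj_map (hG : Good G X) (hH : Good H Y) (Φ : G ≃* H) {k f : G}
    (h : Disjoint (S X k) (S X f)) : Disjoint (S Y (Φ k)) (S Y (Φ f)) := by
  by_contra hc
  rw [Set.not_disjoint_iff_nonempty_inter] at hc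
  obtain ⟨g, hg1, hg⟩ := LM.exists hH ((hH.opn (Φ k)).inter (hH.opn (Φ f))) hc
  have h1 := S_sub_map hH hG Φ.symm (hg.trans Set.inter_subset_left)
  have h2 := S_sub_map hH hG Φ.symm (hg.trans Set.inter_subset_right)
  rw [Φ.symm_apply_apply] at h1 h2
  obtain ⟨x, hx⟩ := M_ne (X := X) (Φ.symm g) (by simpa using hg1)
  have hx' : x ∈ S X (Φ.symm g) := subset_closure hx
  exact Set.disjoint_left.1 h (h1 hx') (h2 hx')

/-- the point relation -/
def R (Φ : G ≃* H) (x : X) (y : Y) : Prop := ∀ f : G, x ∈ S X f ↔ y ∈ S Y (Φ f)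

lemma R_exists (hG : Good G X) (hH : Good H Y) (Φ : G ≃* H) (x : X) : ∃ y : Y, R Φ x y := by
  classical
  obtain ⟨f0, -, hf0, -⟩ := hG.sub x Set.univ isOpen_univ trivial
  let t : G → Set Y := fun f => if x ∈ S X f then S Y (Φ f) else (S Y (Φ f))ᶜ
  have ht : ∀ f, IsClosed (t f) := by
    intro f
    by_cases h : x ∈ S X f
    · simp only [t, h, if_true]; exact isClosed_closure
    · simp only [t, h, if_false]; exact (hH.opn _).isClosed_compl
  obtain ⟨y, -, hy⟩ := (hH.cpt (Φ f0)).inter_iInter_nonempty t ht (by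
    intro u
    let V : G → Set X := fun f => if x ∈ S X f then S X f else (S X f)ᶜ
    have hVo : ∀ f, IsOpen (V f) := by
      intro f
      by_cases h : x ∈ S X f
      · simp only [V, h, if_true]; exact hG.opn f
      · simp only [V, h, if_false]; exact isClosed_closure.isOpen_compl
    have hVx : ∀ f, x ∈ V f := by
      intro f
      by_cases h : x ∈ S X f
      · simp only [V, h, if_true]
      · simp only [V, h, if_false]; exact h
    obtain ⟨g, hg1, hg⟩ := LM.exists hG
      ((hG.opn f0).inter (isOpen_biInter_finset (s := u) (fun f _ => hVo f)))
      ⟨x, hf0, Set.mem_iInter₂.2 fun f _ => hVx f⟩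
    obtain ⟨y, hy⟩ := M_ne (X := Y) (Φ g) (by simpa using hg1)
    have hy' : y ∈ S Y (Φ g) := subset_closure hy
    refine ⟨y, S_sub_map hG hH Φ (hg.trans Set.inter_subset_left) hy', Set.mem_iInter₂.2 ?_⟩
    intro f hf
    have hgf : S X g ⊆ V f := fun z hz => Set.mem_iInter₂.1 (hg hz).2 f hf
    by_cases h : x ∈ S X f
    · simp only [V, h, if_true] at hgf
      simp only [t, h, if_true]
      exact S_sub_map hG hH Φ hgf hy'
    · simp only [V, h, if_false] at hgf
      simp only [t, h, if_false]
      exact Set.disjoint_left.1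
        (S_disj_map hG hH Φ (Set.subset_compl_iff_disjoint_right.1 hgf)) hy')
  refine ⟨y, fun f => ?_⟩
  have := Set.mem_iInter.1 hy f
  by_cases h : x ∈ S X f
  · simp only [t, h, if_true] at this; exact ⟨fun _ => this, fun _ => h⟩
  · simp only [t, h, if_false] at this; exact ⟨fun h' => absurd h' h, fun h' => absurd h' this⟩

lemma R_unique (hH : Good H Y) (Φ : G ≃* H) {x : X} {y y' : Y} (h : R Φ x y) (h' : R Φ x y') :
    y = y' := by
  by_contra hne
  obtain ⟨f, f', h1, h2, h3⟩ := hH.sub y {y'}ᶜ isOpen_compl_singleton hne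
  have hh : ∀ f : H, y ∈ S Y f ↔ y' ∈ S Y f := by
    intro f
    obtain ⟨f, rfl⟩ := Φ.surjective f
    rw [← h f, h' f]
  exact h3 ⟨(hh f).1 h1, (hh f').1 h2⟩ rfl

lemma R_symm {Φ : G ≃* H} {x : X} {y : Y} (h : R Φ x y) : R Φ.symm y x := by
  intro f
  rw [h (Φ.symm f), Φ.apply_symm_apply]

lemma mem_S_conj (g f : G) (x : X) : g • x ∈ S X f ↔ x ∈ S X (g⁻¹ * f * g) := by
  have : (fun x : X => g • x) ⁻¹' (S X f) = S X (g⁻¹ * f * g) := by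
    unfold S
    change (Homeomorph.smul g : X ≃ₜ X) ⁻¹' _ = _
    rw [Homeomorph.preimage_closure]
    congr 1
    ext y
    simp only [M, Set.mem_preimage, Set.mem_setOf_eq, mul_smul, Homeomorph.smul_apply, ne_eq,
      inv_smul_eq_iff]
  rw [← this]; rfl

lemma cont_of_R (hH : Good H Y) (Φ : G ≃* H) (hopn : ∀ g : G, IsOpen (S X g)) (φ : X → Y)
    (h : ∀ x, R Φ x (φ x)) : Continuous φ := by
  rw [continuous_iff_continuousAt]
  intro x
  rw [ContinuousAt, Filter.tendsto_def]
  intro U hU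
  obtain ⟨U', hU', hoU, hxU⟩ := mem_nhds_iff.1 hU
  obtain ⟨f, f', h1, h2, h3⟩ := hH.sub _ U' hoU hxU
  obtain ⟨f, rfl⟩ := Φ.surjective f
  obtain ⟨f', rfl⟩ := Φ.surjective f'
  refine mem_nhds_iff.2 ⟨S X f ∩ S X f', ?_, (hopn f).inter (hopn f'),
    (h x f).2 h1, (h x f').2 h2⟩
  intro z hz
  exact hU' (h3 ⟨(h z f).1 hz.1, (h z f').1 hz.2⟩)

theorem main (hG : Good G X) (hH : Good H Y) (Φ : G ≃* H) :
    ∃ φ : X ≃ₜ Y, ∀ (g : G) (x : X), Φ g • φ x = φ (g • x) := by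
  choose φ hφ using R_exists hG hH Φ
  choose ψ hψ using R_exists hH hG Φ.symm
  refine ⟨⟨⟨φ, ψ, ?_, ?_⟩, cont_of_R hH Φ hG.opn φ hφ, cont_of_R hG Φ.symm hH.opn ψ hψ⟩, ?_⟩
  · intro x
    exact R_unique hG Φ.symm (hψ _) (R_symm (hφ x))
  · intro y
    exact R_unique hH Φ (hφ _) (R_symm (hψ y))
  · intro g x
    refine R_unique hH Φ (x := g • x) ?_ (hφ _)
    intro f
    rw [mem_S_conj, mem_S_conj, hφ x (g⁻¹ * f * g)]
    simp
end

section
variable {X : Type*} [TopologicalSpace X]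

/-- tautological action -/
instance actInst (Γ : Subgroup (X ≃ₜ X)) : MulAction Γ X where
  smul g x := (g : X ≃ₜ X) x
  one_smul _ := rfl
  mul_smul _ _ _ := rfl

lemma smul_eq (Γ : Subgroup (X ≃ₜ X)) (g : Γ) (x : X) : g • x = (g : X ≃ₜ X) x := rfl

instance (Γ : Subgroup (X ≃ₜ X)) : FaithfulSMul Γ X :=
  ⟨fun h => Subtype.ext (Homeomorph.ext h)⟩

instance (Γ : Subgroup (X ≃ₜ X)) : ContinuousConstSMul Γ X :=
  ⟨fun g => (g : X ≃ₜ X).continuous⟩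

lemma three (Γ : Subgroup (X ≃ₜ X)) (h : OrbitAtLeastThree Γ) (x : X) :
    ∃ a b : X ≃ₜ X, a ∈ Γ ∧ b ∈ Γ ∧ a x ≠ x ∧ b x ≠ x ∧ a x ≠ b x := by
  obtain ⟨a, b, c, ha, hb, hc, h1, h2, h3⟩ := h x
  refine ⟨a⁻¹ * b, a⁻¹ * c, Γ.mul_mem (Γ.inv_mem ha) hb, Γ.mul_mem (Γ.inv_mem ha) hc, ?_, ?_, ?_⟩
  · change a.symm (b x) ≠ x
    rw [ne_eq, Homeomorph.symm_apply_eq]; exact h1.symm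
  · change a.symm (c x) ≠ x
    rw [ne_eq, Homeomorph.symm_apply_eq]; exact h2.symm
  · change a.symm (b x) ≠ a.symm (c x)
    exact fun e => h3 (a.symm.injective e)

lemma inv_supp (Γ : Subgroup (X ≃ₜ X)) {A : Set X} (hA : IsClopen A) (hr : RecognizableBy Γ A)
    (γ : X ≃ₜ X) (hγ : γ ∈ Γ) (hd : ∀ y ∈ A, γ y ∉ A) :
    ∃ τ : Γ, A ⊆ S X τ ∧ S X τ ⊆ A ∪ γ '' A := by
  obtain ⟨τ, hτ, h1, -, h3⟩ := hr.2 γ hγ (by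
    ext z
    constructor
    · rintro ⟨⟨y, hy, rfl⟩, hz⟩
      exact hd y hy hz
    · simp)
  refine ⟨⟨τ, hτ⟩, ?_, ?_⟩
  · intro y hy
    apply subset_closure
    change τ y ≠ y
    rw [h1 y hy]
    intro e
    apply hd y hy
    rwa [e]
  · apply closure_minimal
    · intro z hz
      by_contra hc
      rw [Set.mem_union, not_or] at hc
      exact hz (h3 z hc.1 hc.2)
    · exact hA.1.union (γ.isClosed_image.2 hA.1)

lemma good [T2Space X] (hX : HasCompactOpenBasis X) (Γ : Subgroup (X ≃ₜ X))
    (hco : CompactOpenSupports Γ) (hlm : LocallyMoving Γ)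
    (hrec : ∀ A : Set X, IsClopen A → RecognizableBy Γ A) (horb : OrbitAtLeastThree Γ) :
    Good Γ X where
  lm := by
    intro U hU hne
    obtain ⟨g, hg, h1, h⟩ := hlm U hU hne
    exact ⟨⟨g, hg⟩, fun e => h1 (congrArg Subtype.val e), subset_closure.trans h⟩
  cpt g := (hco g g.2).1
  opn g := (hco g g.2).2
  sub := by
    intro x U hU hx
    obtain ⟨a, b, ha, hb, h1, h2, h3⟩ := three Γ horb x
    obtain ⟨P1, Q1, hP1, hQ1, p1, q1, d1⟩ := t2_separation h1
    obtain ⟨P2, Q2, hP2, hQ2, p2, q2, d2⟩ := t2_separation h2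
    obtain ⟨P3, Q3, hP3, hQ3, p3, q3, d3⟩ := t2_separation h3
    obtain ⟨B, hB, hBb⟩ := hX
    obtain ⟨A, hAB, hxA, hAs⟩ := hBb.exists_subset_of_mem_open
      (u := U ∩ (Q1 ∩ Q2) ∩ (a ⁻¹' (P1 ∩ P3) ∩ b ⁻¹' (P2 ∩ Q3)))
      (a := x) ⟨⟨hx, q1, q2⟩, ⟨p1, p3⟩, p2, q3⟩
      ((hU.inter (hQ1.inter hQ2)).inter (((hP1.inter hP3).preimage a.continuous).inter
        ((hP2.inter hQ3).preimage b.continuous)))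
    have hA : IsClopen A := ⟨(hB A hAB).1.isClosed, (hB A hAB).2⟩
    obtain ⟨f, hf1, hf2⟩ := inv_supp Γ hA (hrec A hA) a ha (fun y hy hy' =>
      Set.disjoint_left.1 d1 (hAs hy).2.1.1 (hAs hy').1.2.1)
    obtain ⟨f', hf1', hf2'⟩ := inv_supp Γ hA (hrec A hA) b hb (fun y hy hy' =>
      Set.disjoint_left.1 d2 (hAs hy).2.2.1 (hAs hy').1.2.2)
    refine ⟨f, f', hf1 hxA, hf1' hxA, ?_⟩
    rintro z ⟨hz, hz'⟩
    rcases hf2 hz with hz | ⟨y, hy, rfl⟩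
    · exact (hAs hz).1.1
    rcases hf2' hz' with hz' | ⟨w, hw, hwe⟩
    · exact (hAs hz').1.1
    · exfalso
      refine Set.disjoint_left.1 d3 (hAs hy).2.1.2 ?_
      rw [← hwe]
      exact (hAs hw).2.2.2

end
end Rub

/-- For locally compact Cantor spaces `X₁, X₂` and groups `Γᵢ` of
homeomorphisms with compact open supports which are locally moving, locally flexible,
recognize every clopen set, and have all orbits of size at least 3, every abstract group
isomorphism `Φ : Γ₁ → Γ₂` is spatially implemented. -/
theorem statement1 {X₁ X₂ : Type*} [TopologicalSpace X₁] [TopologicalSpace X₂]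
    [T2Space X₁] [T2Space X₂] [Nonempty X₁] [Nonempty X₂]
    [SecondCountableTopology X₁] [SecondCountableTopology X₂]
    (hX₁ : HasCompactOpenBasis X₁) (hX₂ : HasCompactOpenBasis X₂)
    (hperf₁ : ∀ x : X₁, ¬ IsOpen ({x} : Set X₁))
    (hperf₂ : ∀ x : X₂, ¬ IsOpen ({x} : Set X₂))
    (Γ₁ : Subgroup (X₁ ≃ₜ X₁)) (Γ₂ : Subgroup (X₂ ≃ₜ X₂))
    (hco₁ : CompactOpenSupports Γ₁) (hco₂ : CompactOpenSupports Γ₂)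
    (hlm₁ : LocallyMoving Γ₁) (hlm₂ : LocallyMoving Γ₂)
    (hlf₁ : LocallyFlexible Γ₁) (hlf₂ : LocallyFlexible Γ₂)
    (hrec₁ : ∀ A : Set X₁, IsClopen A → RecognizableBy Γ₁ A)
    (hrec₂ : ∀ A : Set X₂, IsClopen A → RecognizableBy Γ₂ A)
    (horb₁ : OrbitAtLeastThree Γ₁) (horb₂ : OrbitAtLeastThree Γ₂)
    (Φ : Γ₁ ≃* Γ₂) :
    ∃ φ : X₁ ≃ₜ X₂, ∀ γ : Γ₁,
      ⇑((Φ γ : Γ₂) : X₂ ≃ₜ X₂) = ⇑φ ∘ ⇑((γ : Γ₁) : X₁ ≃ₜ X₁) ∘ ⇑φ.symm := by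
  obtain ⟨φ, hφ⟩ := Rub.main (Rub.good hX₁ Γ₁ hco₁ hlm₁ hrec₁ horb₁)
    (Rub.good hX₂ Γ₂ hco₂ hlm₂ hrec₂ horb₂) Φ
  refine ⟨φ, fun γ => ?_⟩
  funext y
  have := hφ γ (φ.symm y)
  rw [φ.apply_symm_apply] at this
  exact this
end

section
/- Let X be a locally compact Hausdorff topological space and let Γ be a subgroup of the group of homeomorphisms of X. Endow Γ with the discrete topology, Γ × X with the product topology, and let Germ(Γ, X) be the quotient of Γ × X by the equivalence relation (γ, x) ∼ (τ, y) iff x = y and γ and τ agree on some open neighbourhood of x, equipped with the quotient topology. Then Germ(Γ, X) is Hausdorff if and only if supp(γ) is clopen in X for every γ ∈ Γ. -/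
/-- The germ equivalence relation on `Γ × X`: `(γ, x) ∼ (τ, y)` iff `x = y` and `γ, τ`
agree on some open neighbourhood of `x`. -/
def germSetoid (X : Type*) [TopologicalSpace X] (Γ : Subgroup (X ≃ₜ X)) :
    Setoid (Γ × X) where
  r p q := p.2 = q.2 ∧ ∃ U : Set X, IsOpen U ∧ p.2 ∈ U ∧
    ∀ z ∈ U, ((p.1 : X ≃ₜ X)) z = ((q.1 : X ≃ₜ X)) z
  iseqv := by
    constructor
    · intro p
      exact ⟨rfl, Set.univ, isOpen_univ, Set.mem_univ _, fun z _ => rfl⟩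
    · rintro p q ⟨h1, U, hU, hx, hEq⟩
      refine ⟨h1.symm, U, hU, ?_, fun z hz => (hEq z hz).symm⟩
      rw [← h1]; exact hx
    · rintro p q r ⟨h1, U, hU, hxU, hEqU⟩ ⟨h2, W, hW, hxW, hEqW⟩
      refine ⟨h1.trans h2, U ∩ W, hU.inter hW, ⟨hxU, ?_⟩,
        fun z hz => (hEqU z hz.1).trans (hEqW z hz.2)⟩
      rw [h1]; exact hxW

/-- The quotient topology on the groupoid of germs, where `Γ` is discrete and `Γ × X` has
the product topology. -/
def germTop (X : Type*) [TopologicalSpace X] (Γ : Subgroup (X ≃ₜ X)) :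
    TopologicalSpace (Quotient (germSetoid X Γ)) :=
  TopologicalSpace.coinduced (Quotient.mk (germSetoid X Γ))
    (@instTopologicalSpaceProd (↥Γ) X ⊥ _)

theorem germ_isOpen_iff {X : Type*} [TopologicalSpace X] (Γ : Subgroup (X ≃ₜ X))
    (S : Set (Quotient (germSetoid X Γ))) :
    @IsOpen _ (germTop X Γ) S ↔
      ∀ σ : Γ, IsOpen {z : X | Quotient.mk (germSetoid X Γ) (σ, z) ∈ S} := by
  letI tΓ : TopologicalSpace Γ := ⊥
  haveI : DiscreteTopology Γ := ⟨rfl⟩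
  constructor
  · intro h σ
    have h' : IsOpen (Quotient.mk (germSetoid X Γ) ⁻¹' S) := isOpen_coinduced.1 h
    exact h'.preimage (f := fun z : X => (σ, z)) (by fun_prop)
  · intro h
    refine isOpen_coinduced.2 ?_
    rw [isOpen_prod_iff]
    intro σ z hz
    refine ⟨{σ}, _, isOpen_discrete _, h σ, rfl, hz, ?_⟩
    rintro ⟨a, b⟩ ⟨ha, hb⟩
    obtain rfl : a = σ := ha
    exact hb

theorem not_mem_Supp_iff {X : Type*} [TopologicalSpace X] (g : X ≃ₜ X) (x : X) :
    x ∉ Supp g ↔ ∃ U : Set X, IsOpen U ∧ x ∈ U ∧ ∀ z ∈ U, g z = z := by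
  unfold Supp
  rw [mem_closure_iff]
  push Not
  refine exists_congr fun U => and_congr_right fun _ => and_congr_right fun _ => ?_
  rw [Set.eq_empty_iff_forall_notMem]
  simp only [Set.mem_inter_iff, Set.mem_ofPred_eq, not_and, not_not]

/-- For a locally compact Hausdorff space `X` and a group `Γ` of
homeomorphisms of `X`, the groupoid of germs `Germ(Γ, X)` is Hausdorff if and only if the
support of every element of `Γ` is clopen. -/
theorem statement11 {X : Type*} [TopologicalSpace X] [T2Space X] [LocallyCompactSpace X]
    (Γ : Subgroup (X ≃ₜ X)) :
    @T2Space (Quotient (germSetoid X Γ)) (germTop X Γ) ↔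
      ∀ γ : X ≃ₜ X, γ ∈ Γ → IsClopen (Supp γ) := by
  letI := germTop X Γ
  constructor
  · intro hT γ hγ
    refine ⟨isClosed_closure, ?_⟩
    have hc : ∀ σ : Γ, Continuous fun z : X => Quotient.mk (germSetoid X Γ) (σ, z) :=
      fun σ => ⟨fun S hS => (germ_isOpen_iff Γ S).1 hS σ⟩
    have hcl := isClosed_eq (hc ⟨γ, hγ⟩) (hc 1)
    rw [← isClosed_compl_iff]
    convert hcl using 1
    ext x
    rw [Set.mem_compl_iff, not_mem_Supp_iff, Set.mem_ofPred_eq, Quotient.eq]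
    exact ⟨fun h => ⟨rfl, h⟩, fun h => h.2⟩
  · intro h
    refine ⟨fun p q => ?_⟩
    induction p using Quotient.inductionOn with | _ p
    induction q using Quotient.inductionOn with | _ q
    obtain ⟨γ, x⟩ := p
    obtain ⟨τ, y⟩ := q
    intro hne
    by_cases hxy : x = y
    · subst hxy
      have hmem : (τ⁻¹ * γ : Γ).1 ∈ Γ := (τ⁻¹ * γ).2
      have hval : ∀ z, (τ⁻¹ * γ : Γ).1 z = z ↔ γ.1 z = τ.1 z := fun z =>
        τ.1.toEquiv.symm_apply_eq
      set W := Supp (τ⁻¹ * γ : Γ).1 with hW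
      have hWo : IsOpen W := (h _ hmem).2
      have key : ∀ z, z ∈ W → ¬ (Quotient.mk (germSetoid X Γ) (γ, z) =
          Quotient.mk (germSetoid X Γ) (τ, z)) := by
        intro z hz he
        obtain ⟨-, U, hU, hzU, hE⟩ := Quotient.exact he
        exact (not_mem_Supp_iff _ z).2 ⟨U, hU, hzU, fun w hw => (hval w).2 (hE w hw)⟩ hz
      have hxW : x ∈ W := by
        by_contra hx
        obtain ⟨U, hU, hxU, hE⟩ := (not_mem_Supp_iff _ x).1 hx
        exact hne (Quotient.sound ⟨rfl, U, hU, hxU, fun w hw => (hval w).1 (hE w hw)⟩)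
      have hop : ∀ σ : Γ, IsOpen {g : Quotient (germSetoid X Γ) |
          ∃ z ∈ W, Quotient.mk (germSetoid X Γ) (σ, z) = g} := by
        intro σ
        refine (germ_isOpen_iff Γ _).2 fun ρ => isOpen_iff_forall_mem_open.2 ?_
        rintro z ⟨w, hw, he⟩
        obtain ⟨hwz, U, hU, hwU, hE⟩ := Quotient.exact he
        obtain rfl : w = z := hwz
        refine ⟨U ∩ W, ?_, hU.inter hWo, hwU, hw⟩
        rintro v ⟨hvU, hvW⟩
        exact ⟨v, hvW, Quotient.sound ⟨rfl, U, hU, hvU, hE⟩⟩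
      refine ⟨_, _, hop γ, hop τ, ⟨x, hxW, rfl⟩, ⟨x, hxW, rfl⟩, ?_⟩
      rw [Set.disjoint_left]
      rintro g ⟨z, hz, rfl⟩ ⟨w, hw, he⟩
      obtain ⟨hwz, -⟩ := Quotient.exact he
      obtain rfl : w = z := hwz
      exact key w hw he.symm
    · obtain ⟨U, V, hU, hV, hx, hy, hd⟩ := t2_separation hxy
      let f : Quotient (germSetoid X Γ) → X := Quotient.lift (fun p => p.2) fun a b hab => hab.1
      have hf : ∀ U : Set X, IsOpen U → IsOpen (f ⁻¹' U) := fun U hU =>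
        (germ_isOpen_iff Γ (f ⁻¹' U)).2 fun _ => hU
      exact ⟨f ⁻¹' U, f ⁻¹' V, hf U hU, hf V hV, hx, hy, hd.preimage f⟩
end

section
/- Let X be a Boolean space and Γ a subgroup of the group of homeomorphisms of X such that every element of Γ has compact open support. Assume every clopen subset of X is recognizable by Γ and every Γ-orbit contains at least 3 points. Then a regular open set A ⊆ X is clopen if and only if both A and its regular complement ∼A = int(X ∖ A) are weakly clopen. -/
/-- A set is regular open if it equals the interior of its closure. -/
def RegOpen {X : Type*} [TopologicalSpace X] (A : Set X) : Prop :=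
  A = interior (closure A)

/-- A regular open set `A` is weakly clopen for `Γ`. -/
def WeaklyClopen {X : Type*} [TopologicalSpace X] (Γ : Subgroup (X ≃ₜ X)) (A : Set X) :
    Prop :=
  ∀ γ : X ≃ₜ X, γ ∈ Γ → ⇑γ '' (A ∩ ⇑γ '' A) = A ∩ ⇑γ '' A →
    ∃ γ' : X ≃ₜ X, γ' ∈ Γ ∧
      (∀ B : Set X, RegOpen B → B ⊆ A ∩ ⇑γ '' A → ⇑γ' '' B = ⇑γ '' B) ∧
      (∀ B : Set X, RegOpen B → B ⊆ interior ((A ∩ ⇑γ '' A)ᶜ) → ⇑γ' '' B = B)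

theorem aux_basis {X : Type*} [TopologicalSpace X] [T2Space X] (hX : HasCompactOpenBasis X)
    {x : X} {V : Set X} (hV : IsOpen V) (hx : x ∈ V) : ∃ U, IsClopen U ∧ x ∈ U ∧ U ⊆ V := by
  obtain ⟨B, hB, hb⟩ := hX
  obtain ⟨U, hU, hxU, hUV⟩ := hb.exists_subset_of_mem_open hx hV
  exact ⟨U, ⟨(hB U hU).1.isClosed, (hB U hU).2⟩, hxU, hUV⟩

theorem aux_regOpen {X : Type*} [TopologicalSpace X] {U : Set X} (hU : IsClopen U) :
    RegOpen U := by
  unfold RegOpen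
  rw [hU.1.closure_eq, hU.2.interior_eq]

theorem aux_agree {X : Type*} [TopologicalSpace X] [T2Space X] (hX : HasCompactOpenBasis X)
    (f g : X ≃ₜ X) {W : Set X} (hW : IsOpen W)
    (h : ∀ B : Set X, RegOpen B → B ⊆ W → ⇑f '' B = ⇑g '' B) {p : X} (hp : p ∈ W) :
    f p = g p := by
  by_contra hne
  obtain ⟨N, M, hN, hM, hpN, hpM, hd⟩ := t2_separation hne
  obtain ⟨C, hC, hpC, hCs⟩ := aux_basis hX (x := p) (V := W ∩ (f ⁻¹' N ∩ g ⁻¹' M))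
    (hW.inter ((hN.preimage f.continuous).inter (hM.preimage g.continuous))) ⟨hp, hpN, hpM⟩
  have e := h C (aux_regOpen hC) (fun q hq => (hCs hq).1)
  have h1 : f p ∈ g '' C := e ▸ ⟨p, hpC, rfl⟩
  obtain ⟨q, hq, hqe⟩ := h1
  have h2 : f p ∈ M := hqe ▸ (hCs hq).2.2
  exact Set.disjoint_left.1 hd hpN h2

theorem aux_key {X : Type*} [TopologicalSpace X] [T2Space X] (hX : HasCompactOpenBasis X)
    (Γ : Subgroup (X ≃ₜ X)) (hrec : ∀ A : Set X, IsClopen A → RecognizableBy Γ A)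
    {A : Set X} (hA : IsOpen A) (hw : WeaklyClopen Γ A) {x : X}
    (hx : x ∈ closure (interior Aᶜ)) {g : X ≃ₜ X} (hg : g ∈ Γ) (hgx : g x ≠ x) :
    x ∉ closure (A ∩ g ⁻¹' A) := by
  intro hcl
  obtain ⟨N, M, hN, hM, hxN, hxM, hd⟩ := t2_separation hgx
  obtain ⟨U, hU, hxU, hUs⟩ := aux_basis hX (x := x) (V := g ⁻¹' N ∩ M)
    ((hN.preimage g.continuous).inter hM) ⟨hxN, hxM⟩
  have hdis : (⇑g '' U) ∩ U = ∅ := by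
    ext q
    simp only [Set.mem_inter_iff, Set.mem_empty_iff_false, iff_false]
    rintro ⟨⟨r, hr, rfl⟩, hq⟩
    exact Set.disjoint_left.1 hd (hUs hr).1 (hUs hq).2
  obtain ⟨τ, hτ, h1, h2, h3⟩ := (hrec U hU).2 g hg hdis
  have hinv : ∀ q, τ (τ q) = q := by
    intro q
    by_cases hq : q ∈ U
    · rw [h1 q hq, h2 _ ⟨q, hq, rfl⟩, g.symm_apply_apply]
    · by_cases hq' : q ∈ g '' U
      · rw [h2 q hq']
        obtain ⟨r, hr, rfl⟩ := hq'
        rw [g.symm_apply_apply, h1 r hr]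
      · rw [h3 q hq hq', h3 q hq hq']
  have hst : ⇑τ '' (A ∩ ⇑τ '' A) = A ∩ ⇑τ '' A := by
    ext q
    constructor
    · rintro ⟨_, ⟨ha, ⟨r, hr, rfl⟩⟩, rfl⟩
      exact ⟨by rw [hinv]; exact hr, _, ha, rfl⟩
    · rintro ⟨ha, r, hr, rfl⟩
      exact ⟨r, ⟨hr, τ r, ha, hinv r⟩, rfl⟩
  obtain ⟨γ, -, ha, hb⟩ := hw τ hτ hst
  have e1 : Set.EqOn γ τ (A ∩ ⇑τ '' A) := fun p hp =>
    aux_agree hX γ τ (hA.inter (τ.isOpenMap _ hA)) ha hp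
  have e2 : Set.EqOn γ id (interior Aᶜ) := fun p hp =>
    aux_agree hX γ (Homeomorph.refl X) isOpen_interior
      (fun B hB hs => by simpa using hb B hB hs)
      (interior_mono (Set.compl_subset_compl.2 Set.inter_subset_left) hp)
  have e2x : γ x = x := e2.closure γ.continuous continuous_id hx
  have hx' : x ∈ closure (A ∩ ⇑τ '' A) := by
    have : x ∈ closure (U ∩ (A ∩ g ⁻¹' A)) := hU.2.inter_closure ⟨hxU, hcl⟩
    refine closure_mono ?_ this
    rintro p ⟨hpU, hpA, hpg⟩
    exact ⟨hpA, τ p, by rw [h1 p hpU]; exact hpg, hinv p⟩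
  have e1x : γ x = τ x := e1.closure γ.continuous τ.continuous hx'
  exact hgx (by rw [← h1 x hxU, ← e1x, e2x])

theorem aux_fwd {X : Type*} [TopologicalSpace X]
    (Γ : Subgroup (X ≃ₜ X)) (hrec : ∀ A : Set X, IsClopen A → RecognizableBy Γ A)
    {A : Set X} (hA : IsClopen A) : WeaklyClopen Γ A := by
  intro γ hγ hst
  have hC : IsClopen (A ∩ ⇑γ '' A) :=
    hA.inter ⟨γ.isClosedMap _ hA.1, γ.isOpenMap _ hA.2⟩
  obtain ⟨τ, hτ, h1, h2⟩ := (hrec _ hC).1 γ hγ hst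
  refine ⟨τ, hτ, fun B _ hs => Set.image_congr fun x hx => h1 x (hs hx), fun B _ hs => ?_⟩
  have : ⇑τ '' B = id '' B :=
    Set.image_congr fun x hx => h2 x (interior_subset (hs hx))
  simpa using this

theorem aux_main {X : Type*} [TopologicalSpace X] [T2Space X] (hX : HasCompactOpenBasis X)
    (Γ : Subgroup (X ≃ₜ X)) (hrec : ∀ A : Set X, IsClopen A → RecognizableBy Γ A)
    {A : Set X} (hA : RegOpen A) (hw : WeaklyClopen Γ A) (hw' : WeaklyClopen Γ (interior Aᶜ))
    {x : X} (hxc : x ∈ closure A) (hxA : x ∉ A) {g k : X ≃ₜ X} (hg : g ∈ Γ) (hk : k ∈ Γ)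
    (hgx : g x ≠ x) (hkx : k x ≠ x) (hgk : g x ≠ k x) : False := by
  have hAo : IsOpen A := by rw [hA]; exact isOpen_interior
  have hBc : interior (interior Aᶜ)ᶜ = A := by
    rw [interior_compl (s := A), compl_compl]; exact hA.symm
  have bd : ∀ y, y ∉ A → y ∈ closure (interior Aᶜ) := by
    intro y hy
    rw [← hBc, interior_compl, Set.mem_compl_iff, not_not] at hy
    exact hy
  have bd' : ∀ y, y ∉ interior Aᶜ → y ∈ closure A := by
    intro y hy
    rwa [interior_compl, Set.mem_compl_iff, not_not] at hy
  have key1 : ∀ f ∈ Γ, f x ≠ x → x ∉ closure (A ∩ f ⁻¹' A) := fun f hf hfx =>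
    aux_key hX Γ hrec hAo hw (bd x hxA) hf hfx
  have hgA : g x ∉ A := fun h => key1 g hg hgx (by
    rw [Set.inter_comm]
    exact (hAo.preimage g.continuous).inter_closure ⟨h, hxc⟩)
  have hgB : g x ∉ interior Aᶜ := fun h =>
    aux_key hX Γ hrec isOpen_interior hw' (by rw [hBc]; exact hxc) hg hgx (by
      rw [Set.inter_comm]
      exact (isOpen_interior.preimage g.continuous).inter_closure ⟨h, bd x hxA⟩)
  have hkg : (k * g⁻¹) (g x) = k x := congrArg k (g.symm_apply_apply x)
  have key2 := aux_key hX Γ hrec isOpen_interior hw' (x := g x)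
    (by rw [hBc]; exact bd' _ hgB) (Γ.mul_mem hk (Γ.inv_mem hg)) (by rw [hkg]; exact hgk.symm)
  have o1 := (isClosed_closure (s := A ∩ g ⁻¹' A)).isOpen_compl
  have o2 := (isClosed_closure (s := A ∩ k ⁻¹' A)).isOpen_compl
  have o3 := (isClosed_closure
    (s := interior Aᶜ ∩ (k * g⁻¹) ⁻¹' interior Aᶜ)).isOpen_compl.preimage g.continuous
  have oV := ((o1.inter o2).inter o3)
  obtain ⟨p, hpV, hpA⟩ := mem_closure_iff.1 hxc _ oV ⟨⟨key1 g hg hgx, key1 k hk hkx⟩, key2⟩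
  have oVA := oV.inter hAo
  have hgp : g p ∈ interior Aᶜ := by
    refine mem_interior.2 ⟨_, ?_, g.isOpenMap _ oVA, ⟨p, ⟨hpV, hpA⟩, rfl⟩⟩
    rintro _ ⟨q, ⟨hq, hqA⟩, rfl⟩ h
    exact hq.1.1 (subset_closure ⟨hqA, h⟩)
  have hkp : k p ∈ interior Aᶜ := by
    refine mem_interior.2 ⟨_, ?_, k.isOpenMap _ oVA, ⟨p, ⟨hpV, hpA⟩, rfl⟩⟩
    rintro _ ⟨q, ⟨hq, hqA⟩, rfl⟩ h
    exact hq.1.2 (subset_closure ⟨hqA, h⟩)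
  refine hpV.2 (subset_closure ⟨hgp, ?_⟩)
  have : (k * g⁻¹) (g p) = k p := congrArg k (g.symm_apply_apply p)
  rw [Set.mem_preimage, this]
  exact hkp

/-- On a Boolean space, if all elements of `Γ` have compact open support,
every clopen set is recognizable by `Γ` and every `Γ`-orbit has at least 3 points, then a
regular open set is clopen iff both it and its regular complement are weakly clopen. -/
theorem statement12 {X : Type*} [TopologicalSpace X] [T2Space X]
    (hX : HasCompactOpenBasis X)
    (Γ : Subgroup (X ≃ₜ X)) (hco : CompactOpenSupports Γ)
    (hrec : ∀ A : Set X, IsClopen A → RecognizableBy Γ A)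
    (horb : OrbitAtLeastThree Γ)
    (A : Set X) (hA : RegOpen A) :
    IsClopen A ↔ (WeaklyClopen Γ A ∧ WeaklyClopen Γ (interior Aᶜ)) := by
  constructor
  · intro h
    refine ⟨aux_fwd Γ hrec h, ?_⟩
    rw [h.compl.2.interior_eq]
    exact aux_fwd Γ hrec h.compl
  · rintro ⟨hw, hw'⟩
    have hAo : IsOpen A := by rw [hA]; exact isOpen_interior
    refine ⟨?_, hAo⟩
    rw [← closure_subset_iff_isClosed]
    intro x hxc
    by_contra hxA
    obtain ⟨a, b, c, ha, hb, hc, hab, hac, hbc⟩ := horb x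
    by_cases h1 : a x = x
    · exact aux_main hX Γ hrec hA hw hw' hxc hxA hb hc
        (fun h => hab (h1.trans h.symm)) (fun h => hac (h1.trans h.symm)) hbc
    · by_cases h2 : b x = x
      · exact aux_main hX Γ hrec hA hw hw' hxc hxA ha hc h1
          (fun h => hbc (h2.trans h.symm)) hac
      · exact aux_main hX Γ hrec hA hw hw' hxc hxA ha hb h1 h2 hab
end

section
/- Let X be a second countable Hausdorff topological space admitting a basis of compact open sets. Then X is compact if and only if the collection of clopen subsets of X is countable. -/
/-- A second countable Boolean space is compact if and only if it has only
countably many clopen subsets. -/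
theorem statement13 {X : Type*} [TopologicalSpace X] [T2Space X]
    [SecondCountableTopology X] (hX : HasCompactOpenBasis X) :
    CompactSpace X ↔ {A : Set X | IsClopen A}.Countable := by
  obtain ⟨B, hB, hBb⟩ := hX
  constructor
  · intro hc
    have hcb := TopologicalSpace.countable_countableBasis X
    have hb := TopologicalSpace.isBasis_countableBasis X
    refine ((Set.countable_ofPred_finite_subset hcb).image Set.sUnion).mono ?_
    intro A hA
    have hAc : IsCompact A := hA.isClosed.isCompact
    obtain ⟨S, hS, hAS⟩ := hb.open_eq_sUnion hA.isOpen
    obtain ⟨T, hT, hTf, hAT⟩ := hAc.elim_finite_subcover_image (b := S) (c := id)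
      (fun s hs => hb.isOpen (hS hs)) (hAS.subset.trans Set.sUnion_eq_biUnion.subset)
    rw [show (⋃ i ∈ T, id i) = ⋃₀ T from Set.sUnion_eq_biUnion.symm] at hAT
    exact ⟨T, ⟨hTf, hT.trans hS⟩,
      Set.Subset.antisymm (hAS ▸ Set.sUnion_subset_sUnion hT) hAT⟩
  · intro hcount
    obtain ⟨T, hTc, hTB, hTU⟩ := TopologicalSpace.isOpen_sUnion_countable B
      (fun s hs => hBb.isOpen hs)
    rw [hBb.sUnion_eq] at hTU
    obtain ⟨U, hU⟩ := (hTc.insert ∅).exists_eq_range (Set.insert_nonempty _ _)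
    have hUc : ∀ n, IsCompact (U n) ∧ IsOpen (U n) := by
      intro n
      have : U n ∈ insert ∅ T := hU ▸ Set.mem_range_self n
      rcases this with h | h
      · rw [h]; exact ⟨isCompact_empty, isOpen_empty⟩
      · exact hB _ (hTB h)
    have hcov : ∀ x, ∃ n, x ∈ U n := by
      intro x
      have hx : x ∈ ⋃₀ T := hTU ▸ Set.mem_univ x
      obtain ⟨t, ht, hxt⟩ := hx
      have : t ∈ Set.range U := hU ▸ Set.mem_insert_of_mem _ ht
      obtain ⟨n, rfl⟩ := this
      exact ⟨n, hxt⟩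
    classical
    let f : X → ℕ := fun x => Nat.find (hcov x)
    have hf : Continuous f := by
      rw [continuous_discrete_rng]
      intro n
      have : f ⁻¹' {n} = U n ∩ ⋂ m ∈ Set.Iio n, (U m)ᶜ := by
        ext x
        simp [f, Nat.find_eq_iff]
      rw [this]
      exact (hUc n).2.inter ((Set.finite_Iio n).isOpen_biInter
        fun m _ => (hUc m).1.isClosed.isOpen_compl)
    by_cases hfin : (Set.range f).Finite
    · refine ⟨?_⟩
      have : (Set.univ : Set X) = ⋃ n ∈ Set.range f, U n := by
        symm
        rw [Set.eq_univ_iff_forall]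
        intro x
        exact Set.mem_biUnion (Set.mem_range_self x) (Nat.find_spec (hcov x))
      rw [this]
      exact hfin.isCompact_biUnion fun n _ => (hUc n).1
    · exfalso
      have hinf : Infinite (Set.range f) := Set.infinite_coe_iff.mpr hfin
      have hcs : Countable {A : Set X | IsClopen A} := hcount.to_subtype
      let g : Set (Set.range f) → {A : Set X | IsClopen A} := fun S =>
        ⟨Set.rangeFactorization f ⁻¹' S, by
          have hc : Continuous (Set.rangeFactorization f) := hf.subtype_mk _
          exact (isClopen_discrete S).preimage hc⟩
      have hg : Function.Injective g := by
        intro S S' h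
        exact Set.preimage_injective.mpr Set.rangeFactorization_surjective
          (congrArg Subtype.val h)
      obtain ⟨e, he⟩ := exists_injective_nat {A : Set X | IsClopen A}
      exact Function.cantor_injective
        (fun S => Infinite.natEmbedding (Set.range f) (e (g S)))
        ((Infinite.natEmbedding _).injective.comp (he.comp hg))
end

section
/- Let X be a second countable Hausdorff topological space admitting a basis of compact open sets, and let A ⊆ X be a clopen set. Then A is compact if and only if the collection {B ⊆ A : B clopen in X} is countable. -/
/-- In a second countable Boolean space, a clopen set `A` is compact if and
only if only countably many clopen sets are contained in `A`. -/
theorem statement14 {X : Type*} [TopologicalSpace X] [T2Space X]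
    [SecondCountableTopology X] (hX : HasCompactOpenBasis X)
    (A : Set X) (hA : IsClopen A) :
    IsCompact A ↔ {B : Set X | IsClopen B ∧ B ⊆ A}.Countable := by
  constructor
  · intro hc
    have hb := TopologicalSpace.isBasis_countableBasis X
    have hcount := TopologicalSpace.countable_countableBasis X
    refine ((Set.countable_setOf_finite_subset hcount).image (fun s => ⋃₀ s)).mono ?_
    rintro B ⟨hB, hBA⟩
    have hBc : IsCompact B := hc.of_isClosed_subset hB.1 hBA
    obtain ⟨s, hs, h⟩ := eq_finite_iUnion_of_isTopologicalBasis_of_isCompact_open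
      (fun i : TopologicalSpace.countableBasis X => (i : Set X))
      (by simpa using hb) B hBc hB.2
    refine ⟨Subtype.val '' s, ⟨hs.image _, ?_⟩, ?_⟩
    · rintro _ ⟨x, -, rfl⟩
      exact x.2
    · simp only [Set.sUnion_image]
      exact h.symm
  · intro hcount
    obtain ⟨Bs, hBs, hbasis⟩ := hX
    obtain ⟨T, hT, hTB, hTU⟩ := TopologicalSpace.isOpen_sUnion_countable Bs
      (fun s hs => (hBs s hs).2)
    obtain ⟨b, hb⟩ := (hT.insert ∅).exists_eq_range ⟨∅, by simp⟩
    have hbk : ∀ n, IsCompact (b n) ∧ IsOpen (b n) := by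
      intro n
      have : b n ∈ insert ∅ T := hb ▸ Set.mem_range_self n
      rcases this with h | h
      · rw [h]; exact ⟨isCompact_empty, isOpen_empty⟩
      · exact hBs _ (hTB h)
    have hbU : ⋃ n, b n = Set.univ := by
      rw [← Set.sUnion_range, ← hb, Set.sUnion_insert, hTU, hbasis.sUnion_eq]
      simp
    have hbc : ∀ n, IsClopen (b n) := fun n => ⟨(hbk n).1.isClosed, (hbk n).2⟩
    have hdc : ∀ n, IsClopen (disjointed b n) := by
      intro n
      exact disjointedRec (p := fun s => IsClopen s) (fun {t i} ht => ht.diff (hbc i)) (hbc n)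
    let D : ℕ → Set X := fun n => A ∩ disjointed b n
    have hD : ∀ n, IsClopen (D n) := fun n => hA.inter (hdc n)
    have hDk : ∀ n, IsCompact (D n) := fun n =>
      (hbk n).1.of_isClosed_subset (hD n).1
        (Set.inter_subset_right.trans (disjointed_subset b n))
    have hDU : ∀ x ∈ A, ∃ n, x ∈ D n := by
      intro x hx
      have : x ∈ ⋃ n, disjointed b n := by rw [iUnion_disjointed, hbU]; trivial
      obtain ⟨n, hn⟩ := Set.mem_iUnion.1 this
      exact ⟨n, hx, hn⟩
    have hDd : ∀ m n x, x ∈ D m → x ∈ D n → m = n := by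
      intro m n x hm hn
      by_contra hne
      exact Set.disjoint_left.1 (disjoint_disjointed b hne) hm.2 hn.2
    by_cases hfin : {n | (D n).Nonempty}.Finite
    · have : A = ⋃ n ∈ {n | (D n).Nonempty}, D n := by
        ext x
        simp only [Set.mem_iUnion]
        constructor
        · intro hx
          obtain ⟨n, hn⟩ := hDU x hx
          exact ⟨n, ⟨x, hn⟩, hn⟩
        · rintro ⟨n, -, hn⟩
          exact hn.1
      rw [this]
      exact hfin.isCompact_biUnion fun n _ => hDk n
    · exfalso
      have hinf : Infinite {n | (D n).Nonempty} := Set.infinite_coe_iff.2 hfin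
      let e := Infinite.natEmbedding {n | (D n).Nonempty}
      have hcl : ∀ S : Set ℕ, IsClopen (⋃ n ∈ S, D n) := by
        intro S
        refine ⟨⟨?_⟩, isOpen_biUnion fun n _ => (hD n).2⟩
        have : (⋃ n ∈ S, D n)ᶜ = Aᶜ ∪ ⋃ n ∈ Sᶜ, D n := by
          ext x
          simp only [Set.mem_compl_iff, Set.mem_union, Set.mem_iUnion, not_exists]
          constructor
          · intro h
            by_cases hx : x ∈ A
            · obtain ⟨n, hn⟩ := hDU x hx
              exact Or.inr ⟨n, fun hS => h n hS hn, hn⟩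
            · exact Or.inl hx
          · rintro (h | ⟨n, hn, hx⟩) m hm hxm
            · exact h hxm.1
            · exact hn (hDd m n x hxm hx ▸ hm)
        rw [this]
        exact hA.compl.2.union (isOpen_biUnion fun n _ => (hD n).2)
      let F : Set ℕ → {B : Set X | IsClopen B ∧ B ⊆ A} := fun S =>
        ⟨⋃ n ∈ (fun k => (e k : ℕ)) '' S, D n, hcl _,
          Set.iUnion₂_subset fun n _ => Set.inter_subset_left⟩
      have hsub : ∀ S S' : Set ℕ, F S = F S' → S ⊆ S' := by
        intro S S' h k hk
        obtain ⟨x, hx⟩ := (e k).2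
        have h1 : x ∈ (F S : Set X) := Set.mem_iUnion₂.2 ⟨_, ⟨k, hk, rfl⟩, hx⟩
        rw [h] at h1
        obtain ⟨_, ⟨j, hj, rfl⟩, hxj⟩ := Set.mem_iUnion₂.1 h1
        have : e j = e k := Subtype.ext (hDd _ _ x hxj hx)
        exact e.injective this ▸ hj
      have hF : Function.Injective F := fun S S' h =>
        (hsub _ _ h).antisymm (hsub _ _ h.symm)
      haveI := hcount.to_subtype
      obtain ⟨g, hg⟩ := Countable.exists_injective_nat {B : Set X | IsClopen B ∧ B ⊆ A}
      exact Function.cantor_injective _ (hg.comp hF)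
end
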